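/- arXiv:2401.06881 — 4 statements merged into one kernel-verified Lean document; each statement's English description precedes it below -/
import Mathlib

section
/- Let H be a strictly 2-balanced graph with at least five edges and m_2(H) > 1. Suppose that every graph G with m(G) ≤ m_2(H) does not have the anti-Ramsey property for H. Then there exists a constant c > 0 such that if p = p(n) ≤ c·n^{-1/m_2(H)}, the probability that G(n,p) has the anti-Ramsey property for H tends to 0 as n → ∞. -/
open SimpleGraph Filter

/-- `f` is the vertex map of a copy of `H` inside `G`. -/
def GraphCopy {V W : Type*} (H : SimpleGraph W) (G : SimpleGraph V) (f : W ↪ V) : Prop :=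
  ∀ ⦃x y : W⦄, H.Adj x y → G.Adj (f x) (f y)

/-- The colouring `χ` admits a monochromatic copy of `H` in `G`. -/
def HasMonoCopy {V W β : Type*} (H : SimpleGraph W) (G : SimpleGraph V)
    (χ : Sym2 V → β) : Prop :=
  ∃ f : W ↪ V, GraphCopy H G f ∧
    ∀ e ∈ H.edgeSet, ∀ e' ∈ H.edgeSet, χ (Sym2.map (⇑f) e) = χ (Sym2.map (⇑f) e')

/-- The colouring `χ` admits a rainbow copy of `H` in `G`. -/
def HasRainbowCopy {V W β : Type*} (H : SimpleGraph W) (G : SimpleGraph V)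
    (χ : Sym2 V → β) : Prop :=
  ∃ f : W ↪ V, GraphCopy H G f ∧
    ∀ e ∈ H.edgeSet, ∀ e' ∈ H.edgeSet, e ≠ e' → χ (Sym2.map (⇑f) e) ≠ χ (Sym2.map (⇑f) e')

/-- `G` has the constrained Ramsey property for `(H₁, H₂)`. -/
def ConstrainedRamsey {V W₁ W₂ : Type*} (G : SimpleGraph V)
    (H₁ : SimpleGraph W₁) (H₂ : SimpleGraph W₂) : Prop :=
  ∀ (β : Type) (χ : Sym2 V → β), HasMonoCopy H₁ G χ ∨ HasRainbowCopy H₂ G χ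

/-- `χ` is a proper edge-colouring of `G`. -/
def ProperEdgeColoring {V β : Type*} (G : SimpleGraph V) (χ : Sym2 V → β) : Prop :=
  ∀ e ∈ G.edgeSet, ∀ e' ∈ G.edgeSet, e ≠ e' → (∃ v, v ∈ e ∧ v ∈ e') → χ e ≠ χ e'

/-- `G` has the anti-Ramsey property for `H`. -/
def AntiRamsey {V W : Type*} (G : SimpleGraph V) (H : SimpleGraph W) : Prop :=
  ∀ (β : Type) (χ : Sym2 V → β), ProperEdgeColoring G χ → HasRainbowCopy H G χ

/-- The value `d₂` computed from the number of edges `e` and vertices `v`. -/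
noncomputable def d2val (e v : ℕ) : ℝ :=
  if 1 ≤ e ∧ 3 ≤ v then ((e : ℝ) - 1) / ((v : ℝ) - 2)
  else if e = 1 ∧ v = 2 then 1 / 2
  else 0

/-- `m(G)`: the maximum of `e(J)/v(J)` over subgraphs `J` of `G` with at least one vertex. -/
noncomputable def maxDensity {V : Type*} (G : SimpleGraph V) : ℝ :=
  sSup {x : ℝ | ∃ J : G.Subgraph, J.verts.Nonempty ∧
    x = (J.edgeSet.ncard : ℝ) / (J.verts.ncard : ℝ)}

/-- `m₂(G)`: the maximum of `d₂(J)` over subgraphs `J` of `G`. -/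
noncomputable def twoDensity {V : Type*} (G : SimpleGraph V) : ℝ :=
  sSup {x : ℝ | ∃ J : G.Subgraph, x = d2val J.edgeSet.ncard J.verts.ncard}

/-- `G` is strictly 2-balanced. -/
def StrictlyTwoBalanced {V : Type*} (G : SimpleGraph V) : Prop :=
  ∀ J : G.Subgraph, J ≠ ⊤ →
    d2val J.edgeSet.ncard J.verts.ncard < d2val G.edgeSet.ncard (Nat.card V)

/-- The star `K_{1,k}` with centre `0`. -/
def starGraph (k : ℕ) : SimpleGraph (Fin (k + 1)) :=
  SimpleGraph.fromRel (fun i _ => i = 0)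

/-- The minimum degree `δ(G)`. -/
noncomputable def minDeg {V : Type*} (G : SimpleGraph V) : ℕ :=
  sInf {d : ℕ | ∃ v : V, d = (G.neighborSet v).ncard}

noncomputable instance (n : ℕ) : Fintype (SimpleGraph (Fin n)) :=
  Fintype.ofInjective (fun G : SimpleGraph (Fin n) => G.edgeSet)
    fun _ _ h => SimpleGraph.edgeSet_inj.mp h

open Classical in
/-- The probability that `G(n,p)` satisfies the property `P`. -/
noncomputable def grProb (n : ℕ) (p : ℝ) (P : SimpleGraph (Fin n) → Prop) : ℝ :=
  ∑ G : SimpleGraph (Fin n),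
    if P G then p ^ G.edgeSet.ncard * (1 - p) ^ (n.choose 2 - G.edgeSet.ncard) else 0

/-- `s` is the vertex set of a triangle of `T`. -/
def IsTriangleSet {V : Type*} (T : SimpleGraph V) (s : Set V) : Prop :=
  ∃ x y z : V, T.Adj x y ∧ T.Adj x z ∧ T.Adj y z ∧ s = {x, y, z}

/-- `T` is triangle-connected. -/
def TriangleConnected {V : Type*} (T : SimpleGraph V) : Prop :=
  (∀ v : V, ∃ w, T.Adj v w) ∧
  (∀ u v : V, T.Adj u v → ∃ w, T.Adj u w ∧ T.Adj v w) ∧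
  (∀ s t : Set V, IsTriangleSet T s → IsTriangleSet T t →
    Relation.ReflTransGen
      (fun x y : Set V => IsTriangleSet T x ∧ IsTriangleSet T y ∧ (x ∩ y).ncard = 2) s t)

/-- A triangle sequence `T₀, …, T_ℓ` in `T`, together with the chosen vertices `v i`
and base edges `a i`–`b i`. -/
structure TriangleSeq {V : Type*} (T : SimpleGraph V) (ℓ : ℕ) where
  G : ℕ → T.Subgraph
  v : ℕ → V
  a : ℕ → V
  b : ℕ → V
  init : ∃ x y z : V, ∃ (hxy : T.Adj x y) (hxz : T.Adj x z) (hyz : T.Adj y z),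
    G 0 = T.subgraphOfAdj hxy ⊔ T.subgraphOfAdj hxz ⊔ T.subgraphOfAdj hyz
  newVert : ∀ i, 1 ≤ i → i ≤ ℓ → v i ∉ (G (i - 1)).verts
  baseEdge : ∀ i, 1 ≤ i → i ≤ ℓ →
    (G (i - 1)).Adj (a i) (b i) ∧ T.Adj (v i) (a i) ∧ T.Adj (v i) (b i)
  vertsEq : ∀ i, 1 ≤ i → i ≤ ℓ → (G i).verts = (G (i - 1)).verts ∪ {v i}
  adjEq : ∀ i, 1 ≤ i → i ≤ ℓ → ∀ x y : V, (G i).Adj x y ↔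
    ((G (i - 1)).Adj x y ∨ (x = v i ∧ y ∈ (G (i - 1)).verts ∧ T.Adj x y)
      ∨ (y = v i ∧ x ∈ (G (i - 1)).verts ∧ T.Adj x y))

/-- `deg(v_i, T_{i-1})`: the number of neighbours of `v i` (in `T`) inside `T_{i-1}`. -/
noncomputable def TriangleSeq.deg {V : Type*} {T : SimpleGraph V} {ℓ : ℕ}
    (s : TriangleSeq T ℓ) (i : ℕ) : ℕ :=
  ((s.G (i - 1)).verts ∩ T.neighborSet (s.v i)).ncard

/-- `r(T₀, …, T_ℓ) = Σ_{i ∈ [ℓ]} (deg(v_i, T_{i-1}) − 2)`. -/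
noncomputable def TriangleSeq.r {V : Type*} {T : SimpleGraph V} {ℓ : ℕ}
    (s : TriangleSeq T ℓ) : ℤ :=
  ∑ i ∈ Finset.Icc 1 ℓ, ((s.deg i : ℤ) - 2)

/-- Step `i` is regular. -/
def TriangleSeq.Regular {V : Type*} {T : SimpleGraph V} {ℓ : ℕ}
    (s : TriangleSeq T ℓ) (i : ℕ) : Prop :=
  s.deg i = 2

/-- A `ρ`-minimal triangle sequence. -/
def RhoMinimal {V : Type*} {T : SimpleGraph V} {ℓ : ℕ} (ρ : ℕ)
    (s : TriangleSeq T ℓ) : Prop :=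
  (ρ : ℤ) ≤ s.r ∧ ∀ (ℓ' : ℕ) (s' : TriangleSeq T ℓ'), (ρ : ℤ) ≤ s'.r → ¬ s'.G ℓ' < s.G ℓ


open Classical in
/-- The edge set of the image of `H` under the vertex map `f`. -/
noncomputable def copyEdges {V A : Type*} [Fintype V] (H : SimpleGraph V) (f : V → A) :
    Finset (Sym2 A) :=
  H.edgeFinset.image (Sym2.map f)

open Classical in
/-- The set of vertices covered by a set of edges. -/
noncomputable def endpoints {A : Type*} [Fintype A] (E : Finset (Sym2 A)) : Finset A :=
  Finset.univ.filter fun u => ∃ e ∈ E, u ∈ e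

/-- The integer `(e(H) - 1) v(E) - (v(H) - 2) e(E)`. It is negative precisely when the graph
spanned by `E` is denser than `(e(H) - 1) / (v(H) - 2)`. -/
noncomputable def slack {V A : Type*} [Fintype V] [Fintype A] (H : SimpleGraph V)
    (E : Finset (Sym2 A)) : ℤ :=
  ((H.edgeSet.ncard : ℤ) - 1) * (endpoints E).card - ((Fintype.card V : ℤ) - 2) * E.card

/-- Every proper nonempty set of edges of `F` is crossed by a copy of `H` in `F`. -/
def CopyConnected {V A : Type*} [Fintype V] (H : SimpleGraph V) (F : SimpleGraph A) : Prop :=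
  ∀ E : Finset (Sym2 A), E.Nonempty → (E : Set (Sym2 A)) ⊂ F.edgeSet →
    ∃ f : V ↪ A, (copyEdges H f : Set (Sym2 A)) ⊆ F.edgeSet ∧
      (∃ e ∈ E, e ∈ copyEdges H f) ∧ ¬ copyEdges H f ⊆ E

section Copies

variable {V A : Type*} [Fintype V] [Fintype A] {H : SimpleGraph V}

lemma mem_endpoints {E : Finset (Sym2 A)} {u : A} : u ∈ endpoints E ↔ ∃ e ∈ E, u ∈ e := by
  simp [endpoints]

omit [Fintype A] in
lemma mem_copyEdges {f : V → A} {e : Sym2 A} :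
    e ∈ copyEdges H f ↔ ∃ d ∈ H.edgeSet, Sym2.map f d = e := by
  simp [copyEdges]

omit [Fintype A] in
lemma card_copyEdges (f : V ↪ A) : (copyEdges H f).card = H.edgeSet.ncard := by
  classical
  rw [copyEdges, Finset.card_image_of_injective _ (Sym2.map.injective f.injective),
    Set.ncard_eq_toFinset_card', edgeFinset]

lemma endpoints_union [DecidableEq A] (E E' : Finset (Sym2 A)) :
    endpoints (E ∪ E') = endpoints E ∪ endpoints E' := by
  ext u
  simp only [mem_endpoints, Finset.mem_union]
  grind

lemma four_le_card (h5 : 5 ≤ H.edgeSet.ncard) : 4 ≤ Fintype.card V := by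
  classical
  by_contra! h
  have h1 := H.card_edgeFinset_le_card_choose_two
  have h2 : H.edgeFinset.card = H.edgeSet.ncard := by
    rw [Set.ncard_eq_toFinset_card', edgeFinset]
  have h3 := Nat.choose_le_choose 2 (show Fintype.card V ≤ 3 by omega)
  norm_num [Nat.choose] at h3
  omega

lemma d2val_eq {e v : ℕ} (he : 1 ≤ e) (hv : 3 ≤ v) :
    d2val e v = ((e : ℝ) - 1) / ((v : ℝ) - 2) := by
  simp [d2val, he, hv]

lemma twoDensity_eq (hbal : StrictlyTwoBalanced H) (h5 : 5 ≤ H.edgeSet.ncard) :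
    twoDensity H = ((H.edgeSet.ncard : ℝ) - 1) / ((Fintype.card V : ℝ) - 2) := by
  have h4 := four_le_card h5
  rw [← d2val_eq (by omega) (by omega)]
  refine IsGreatest.csSup_eq ⟨⟨⊤, by simp [Set.ncard_univ]⟩, ?_⟩
  rintro x ⟨J, rfl⟩
  by_cases hJ : J = ⊤
  · subst hJ
    simp [Set.ncard_univ]
  · simpa using (hbal J hJ).le

lemma exists_adj (hbal : StrictlyTwoBalanced H) (h5 : 5 ≤ H.edgeSet.ncard) (x : V) :
    ∃ y, H.Adj x y := by
  by_contra! hx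
  have h4 := four_le_card h5
  let J : H.Subgraph :=
    { verts := {x}ᶜ
      Adj := H.Adj
      adj_sub := id
      edge_vert := fun {v w} h hv => hx w (by rw [← show v = x from hv]; exact h)
      symm := H.symm }
  have hJe : J.edgeSet = H.edgeSet := by
    ext e
    induction e with
    | _ a b => exact Iff.rfl
  have hJv : J.verts.ncard = Fintype.card V - 1 := by
    rw [Set.ncard_compl]
    simp
  have h := hbal J (fun h => by
    have : x ∈ J.verts := by rw [h]; trivial
    exact this rfl)
  rw [hJe, hJv, d2val_eq (by omega) (by omega), Nat.card_eq_fintype_card,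
    d2val_eq (by omega) (by omega)] at h
  have h4' : (4 : ℝ) ≤ Fintype.card V := by exact_mod_cast h4
  have h5' : (5 : ℝ) ≤ H.edgeSet.ncard := by exact_mod_cast h5
  rw [Nat.cast_sub (by omega)] at h
  push_cast at h
  rw [div_lt_div_iff₀ (by linarith) (by linarith)] at h
  nlinarith

lemma endpoints_copyEdges [DecidableEq A] (hbal : StrictlyTwoBalanced H)
    (h5 : 5 ≤ H.edgeSet.ncard) (f : V ↪ A) :
    endpoints (copyEdges H f) = Finset.univ.map f := by
  ext u
  simp only [mem_endpoints, mem_copyEdges, Finset.mem_map, Finset.mem_univ, true_and]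
  constructor
  · rintro ⟨_, ⟨d, -, rfl⟩, hu⟩
    obtain ⟨x, -, hx⟩ := Sym2.mem_map.1 hu
    exact ⟨x, hx⟩
  · rintro ⟨x, rfl⟩
    obtain ⟨y, hy⟩ := exists_adj hbal h5 x
    exact ⟨s(f x, f y), ⟨s(x, y), hy, rfl⟩, by simp⟩

open Classical in
/-- The number of vertices of the copy `f` covered by `E`. -/
noncomputable def overlap (E : Finset (Sym2 A)) (f : V → A) : ℕ :=
  (Finset.univ.filter fun x => f x ∈ endpoints E).card

lemma card_endpoints_union [DecidableEq A] (hbal : StrictlyTwoBalanced H)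
    (h5 : 5 ≤ H.edgeSet.ncard) (E : Finset (Sym2 A)) (f : V ↪ A) :
    (endpoints (E ∪ copyEdges H f)).card + overlap E f =
      (endpoints E).card + Fintype.card V := by
  classical
  rw [endpoints_union, endpoints_copyEdges hbal h5]
  have h := Finset.card_union_add_card_inter (endpoints E) (Finset.univ.map f)
  have h2 : (endpoints E ∩ Finset.univ.map f).card = overlap E f := by
    rw [overlap, ← Finset.card_map f]
    congr 1
    ext u
    simp only [Finset.mem_inter, Finset.mem_map, Finset.mem_filter, Finset.mem_univ, true_and]
    grind
  rw [← h2, h, Finset.card_map, Finset.card_univ]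

/-- The part of `H` that the copy `f` maps into `E`. -/
def copyTrace (H : SimpleGraph V) (E : Finset (Sym2 A)) (f : V → A) : H.Subgraph where
  verts := {x | f x ∈ endpoints E}
  Adj x y := H.Adj x y ∧ s(f x, f y) ∈ E
  adj_sub h := h.1
  edge_vert h := mem_endpoints.2 ⟨_, h.2, by simp⟩
  symm := ⟨fun _ _ h => ⟨h.1.symm, by rw [Sym2.eq_swap]; exact h.2⟩⟩

lemma ncard_copyTrace_verts (E : Finset (Sym2 A)) (f : V → A) :
    (copyTrace H E f).verts.ncard = overlap E f := by
  classical
  rw [overlap, ← Set.ncard_coe_finset]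
  congr 1
  ext x
  simp [copyTrace]

omit [Fintype V] in
lemma mem_copyTrace_edgeSet {E : Finset (Sym2 A)} {f : V → A} {d : Sym2 V} :
    d ∈ (copyTrace H E f).edgeSet ↔ d ∈ H.edgeSet ∧ Sym2.map f d ∈ E := by
  induction d with
  | _ a b => exact Iff.rfl

lemma ncard_copyTrace_edgeSet [DecidableEq A] (E : Finset (Sym2 A)) (f : V ↪ A) :
    (copyTrace H E f).edgeSet.ncard = (E ∩ copyEdges H f).card := by
  rw [← Set.ncard_image_of_injective _ (Sym2.map.injective f.injective),
    ← Set.ncard_coe_finset]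
  congr 1
  ext e
  simp only [Set.mem_image, mem_copyTrace_edgeSet, Finset.coe_inter, Set.mem_inter_iff,
    Finset.mem_coe, mem_copyEdges]
  grind

lemma slack_union_copyEdges [DecidableEq A] (hbal : StrictlyTwoBalanced H)
    (h5 : 5 ≤ H.edgeSet.ncard) {E : Finset (Sym2 A)} {f : V ↪ A}
    (hmeet : ∃ e ∈ E, e ∈ copyEdges H f) (hnot : ¬ copyEdges H f ⊆ E) :
    2 ≤ overlap E f ∧ slack H (E ∪ copyEdges H f) ≤ slack H E ∧
      (3 ≤ overlap E f → slack H (E ∪ copyEdges H f) < slack H E) := by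
  have h4 := four_le_card h5
  have hV := card_endpoints_union hbal h5 E f
  have hE := Finset.card_union_add_card_inter E (copyEdges H f)
  rw [card_copyEdges] at hE
  set k := (E ∩ copyEdges H f).card with hk
  have hk1 : 1 ≤ k := by
    obtain ⟨e, he, he'⟩ := hmeet
    exact Finset.card_pos.2 ⟨e, Finset.mem_inter.2 ⟨he, he'⟩⟩
  have hj2 : 2 ≤ overlap E f := by
    obtain ⟨e, he, he'⟩ := hmeet
    obtain ⟨d, hd, rfl⟩ := mem_copyEdges.1 he'
    induction d with
    | _ a b =>
      have hab : a ≠ b := H.ne_of_adj hd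
      classical
      rw [overlap, ← Finset.card_pair hab]
      refine Finset.card_le_card fun x hx => ?_
      simp only [Finset.mem_insert, Finset.mem_singleton] at hx
      simp only [Finset.mem_filter, Finset.mem_univ, true_and, mem_endpoints]
      refine ⟨_, he, ?_⟩
      rcases hx with rfl | rfl <;> simp
  have hproper : copyTrace H E f ≠ ⊤ := by
    intro h
    apply hnot
    intro e he
    obtain ⟨d, hd, rfl⟩ := mem_copyEdges.1 he
    have : d ∈ (copyTrace H E f).edgeSet := by rw [h]; simpa using hd
    exact (mem_copyTrace_edgeSet.1 this).2
  have hd := hbal _ hproper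
  rw [ncard_copyTrace_verts, ncard_copyTrace_edgeSet, ← hk, Nat.card_eq_fintype_card,
    d2val_eq (e := H.edgeSet.ncard) (by omega) (by omega)] at hd
  have h3 : 3 ≤ overlap E f → slack H (E ∪ copyEdges H f) < slack H E := by
    intro hj3
    rw [d2val_eq hk1 hj3, div_lt_div_iff₀ (by
      have : (3 : ℝ) ≤ overlap E f := by exact_mod_cast hj3
      linarith) (by
      have : (4 : ℝ) ≤ Fintype.card V := by exact_mod_cast h4
      linarith)] at hd
    have hd' : ((k : ℤ) - 1) * (Fintype.card V - 2) <
        (H.edgeSet.ncard - 1) * (overlap E f - 2) := by exact_mod_cast hd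
    unfold slack
    zify at hV hE
    rw [show ((endpoints (E ∪ copyEdges H f)).card : ℤ) =
      (endpoints E).card + Fintype.card V - overlap E f by linarith,
      show ((E ∪ copyEdges H f).card : ℤ) = E.card + H.edgeSet.ncard - k by linarith]
    linarith
  refine ⟨hj2, ?_, h3⟩
  rcases hj2.lt_or_eq with h | h
  · exact (h3 h).le
  have hk' : k ≤ 1 := by
    rw [hk, ← ncard_copyTrace_edgeSet, Set.ncard_le_one_iff]
    rw [← ncard_copyTrace_verts (H := H), eq_comm, Set.ncard_eq_two] at h
    obtain ⟨x, y, -, hxy⟩ := h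
    have key : ∀ d ∈ (copyTrace H E f).edgeSet, d = s(x, y) := by
      intro d hd
      induction d with
      | _ a b =>
        have ha : a ∈ (copyTrace H E f).verts := (copyTrace H E f).edge_vert hd
        have hb : b ∈ (copyTrace H E f).verts :=
          (copyTrace H E f).edge_vert (Subgraph.Adj.symm hd)
        have hab : a ≠ b := H.ne_of_adj ((copyTrace H E f).adj_sub hd)
        rw [hxy] at ha hb
        simp only [Set.mem_insert_iff, Set.mem_singleton_iff] at ha hb
        rw [Sym2.eq_iff]
        grind
    intro a b ha hb
    rw [key a ha, key b hb]
  unfold slack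
  zify at hV hE
  rw [show ((endpoints (E ∪ copyEdges H f)).card : ℤ) =
    (endpoints E).card + Fintype.card V - 2 by
      have : (overlap E f : ℤ) = 2 := by exact_mod_cast h.symm
      linarith,
    show ((E ∪ copyEdges H f).card : ℤ) = E.card + H.edgeSet.ncard - 1 by
      have : (k : ℤ) = 1 := by exact_mod_cast le_antisymm hk' hk1
      linarith]
  linarith

end Copies
section Deterministic

variable {V A : Type*} [Fintype V] [Fintype A] {H : SimpleGraph V}

lemma edgeSet_fromEdgeSet_of_subset {B : Type*} {F : SimpleGraph B} {s : Set (Sym2 B)}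
    (hs : s ⊆ F.edgeSet) : (fromEdgeSet s).edgeSet = s := by
  rw [edgeSet_fromEdgeSet, sdiff_eq_left, Set.disjoint_left]
  exact fun e he hd => F.not_isDiag_of_mem_edgeSet (hs he) hd

omit [Fintype A] in
lemma copyEdges_subset_iff {F : SimpleGraph A} {f : V ↪ A} :
    (copyEdges H f : Set (Sym2 A)) ⊆ F.edgeSet ↔ GraphCopy H F f := by
  constructor
  · intro h x y hxy
    exact h (mem_copyEdges.2 ⟨s(x, y), hxy, rfl⟩)
  · intro h e he
    obtain ⟨d, hd, rfl⟩ := mem_copyEdges.1 he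
    induction d with
    | _ a b => exact h hd

lemma AntiRamsey.exists_copyConnected {G : SimpleGraph A} (hG : AntiRamsey G H) :
    ∃ F ≤ G, AntiRamsey F H ∧ CopyConnected H F := by
  classical
  obtain ⟨F, hFG, hF⟩ :=
    (Set.toFinite {F : SimpleGraph A | AntiRamsey F H}).exists_le_minimal hG
  refine ⟨F, hFG, hF.prop, fun E hE hEF => ?_⟩
  by_contra! hno
  have hnot : ∀ s ⊂ F.edgeSet, ¬ AntiRamsey (fromEdgeSet s) H := by
    intro s hs h
    have hle : fromEdgeSet s ≤ F := by
      rw [← edgeSet_subset_edgeSet, edgeSet_fromEdgeSet_of_subset hs.subset]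
      exact hs.subset
    have := edgeSet_subset_edgeSet.2 (hF.le_of_le h hle)
    rw [edgeSet_fromEdgeSet_of_subset hs.subset] at this
    exact hs.not_subset this
  have h2ss : F.edgeSet \ E ⊂ F.edgeSet := by
    obtain ⟨e, he⟩ := hE
    exact ⟨Set.sdiff_subset, fun h => (h (hEF.subset he)).2 he⟩
  have h1 := hnot _ hEF
  have h2 := hnot _ h2ss
  simp only [AntiRamsey, not_forall] at h1 h2
  obtain ⟨β₁, χ₁, hp₁, hr₁⟩ := h1
  obtain ⟨β₂, χ₂, hp₂, hr₂⟩ := h2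
  rw [ProperEdgeColoring, edgeSet_fromEdgeSet_of_subset hEF.subset] at hp₁
  rw [ProperEdgeColoring, edgeSet_fromEdgeSet_of_subset h2ss.subset] at hp₂
  let χ : Sym2 A → β₁ ⊕ β₂ := fun e => if e ∈ E then Sum.inl (χ₁ e) else Sum.inr (χ₂ e)
  obtain ⟨f, hf, hrain⟩ := hF.prop _ χ (by
    intro e he e' he' hne hv
    by_cases h : e ∈ E <;> by_cases h' : e' ∈ E <;> simp only [χ, h, h', if_true, if_false]
    · exact fun h'' => hp₁ e h e' h' hne hv (Sum.inl.inj h'')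
    · simp
    · simp
    · exact fun h'' => hp₂ e ⟨he, h⟩ e' ⟨he', h'⟩ hne hv (Sum.inr.inj h''))
  have hfF := copyEdges_subset_iff.2 hf
  by_cases hmeet : ∃ e ∈ E, e ∈ copyEdges H f
  · have hsub := hno f hfF hmeet
    refine hr₁ ⟨f, copyEdges_subset_iff.1 ?_, fun d hd d' hd' hne heq => ?_⟩
    · rw [edgeSet_fromEdgeSet_of_subset hEF.subset]
      exact_mod_cast hsub
    · refine hrain d hd d' hd' hne ?_
      have h := hsub (mem_copyEdges.2 ⟨d, hd, rfl⟩)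
      have h' := hsub (mem_copyEdges.2 ⟨d', hd', rfl⟩)
      simp only [χ, h, h', if_true, heq]
  · push Not at hmeet
    refine hr₂ ⟨f, copyEdges_subset_iff.1 ?_, fun d hd d' hd' hne heq => ?_⟩
    · rw [edgeSet_fromEdgeSet_of_subset h2ss.subset]
      exact fun e he => ⟨hfF he, fun h => hmeet e h he⟩
    · refine hrain d hd d' hd' hne ?_
      have h : Sym2.map f d ∉ E := fun h => hmeet _ h (mem_copyEdges.2 ⟨d, hd, rfl⟩)
      have h' : Sym2.map f d' ∉ E := fun h => hmeet _ h (mem_copyEdges.2 ⟨d', hd', rfl⟩)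
      simp only [χ, h, h', if_false, heq]

omit [Fintype V] in
lemma exists_dense_subgraph {F : SimpleGraph A} {m : ℝ} (hm : 0 ≤ m) (hF : m < maxDensity F) :
    ∃ J : F.Subgraph, m * J.verts.ncard < J.edgeSet.ncard := by
  by_contra! h
  refine hF.not_ge (Real.sSup_le ?_ hm)
  rintro x ⟨J, hJ, rfl⟩
  have : (0 : ℝ) < J.verts.ncard := by
    exact_mod_cast (Set.ncard_pos (Set.toFinite _)).2 hJ
  rw [div_le_iff₀ this]
  exact h J

lemma CopyConnected.exists_slack_neg (hbal : StrictlyTwoBalanced H)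
    (h5 : 5 ≤ H.edgeSet.ncard) {F : SimpleGraph A} (hF : CopyConnected H F)
    (hd : twoDensity H < maxDensity F) :
    ∃ E : Finset (Sym2 A), (E : Set (Sym2 A)) = F.edgeSet ∧ slack H E < 0 := by
  classical
  have h4 := four_le_card h5
  have h4' : (4 : ℝ) ≤ Fintype.card V := by exact_mod_cast h4
  have h5' : (5 : ℝ) ≤ H.edgeSet.ncard := by exact_mod_cast h5
  rw [twoDensity_eq hbal h5] at hd
  obtain ⟨J, hJ⟩ := exists_dense_subgraph
    (div_nonneg (by linarith) (by linarith)) hd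
  have hJslack : slack H J.edgeSet.toFinset < 0 := by
    have hle : (endpoints J.edgeSet.toFinset).card ≤ J.verts.ncard := by
      rw [← Set.ncard_coe_finset]
      refine Set.ncard_le_ncard (fun u hu => ?_) (Set.toFinite _)
      obtain ⟨e, he, hu⟩ := mem_endpoints.1 hu
      exact J.mem_verts_of_mem_edge (Set.mem_toFinset.1 he) hu
    have hle' : ((endpoints J.edgeSet.toFinset).card : ℝ) ≤ J.verts.ncard := by
      exact_mod_cast hle
    rw [div_mul_eq_mul_div, div_lt_iff₀ (by linarith), Set.ncard_eq_toFinset_card' J.edgeSet]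
      at hJ
    have : ((H.edgeSet.ncard : ℝ) - 1) * (endpoints J.edgeSet.toFinset).card -
        ((Fintype.card V : ℝ) - 2) * J.edgeSet.toFinset.card < 0 := by
      nlinarith
    unfold slack
    exact_mod_cast this
  let S : Set (Finset (Sym2 A)) := {E | (E : Set (Sym2 A)) ⊆ F.edgeSet ∧ slack H E < 0}
  obtain ⟨E, -, hE⟩ := (Set.toFinite S).exists_le_maximal
    (show J.edgeSet.toFinset ∈ S from ⟨by simpa using J.edgeSet_subset, hJslack⟩)
  refine ⟨E, ?_, hE.prop.2⟩
  by_contra hne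
  have hEne : E.Nonempty := by
    rw [Finset.nonempty_iff_ne_empty]
    rintro rfl
    have := hE.prop.2
    simp [slack, endpoints] at this
  obtain ⟨f, hfF, hmeet, hnot⟩ := hF E hEne (hE.prop.1.ssubset_of_ne hne)
  have hs := (slack_union_copyEdges hbal h5 hmeet hnot).2.1
  have := hE.le_of_ge (y := E ∪ copyEdges H f)
    ⟨by simpa using ⟨hE.prop.1, hfF⟩, hs.trans_lt hE.prop.2⟩ Finset.subset_union_left
  exact hnot (Finset.subset_union_right.trans this)

end Deterministic

section Probability

lemma grProb_nonneg {n : ℕ} {p : ℝ} (h0 : 0 ≤ p) (h1 : p ≤ 1) (P : SimpleGraph (Fin n) → Prop) :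
    0 ≤ grProb n p P := by
  have : 0 ≤ 1 - p := by linarith
  exact Finset.sum_nonneg fun G _ => by split_ifs <;> positivity

lemma grProb_mono {n : ℕ} {p : ℝ} (h0 : 0 ≤ p) (h1 : p ≤ 1)
    {P Q : SimpleGraph (Fin n) → Prop} (h : ∀ G, P G → Q G) : grProb n p P ≤ grProb n p Q := by
  have : 0 ≤ 1 - p := by linarith
  refine Finset.sum_le_sum fun G _ => ?_
  by_cases hP : P G
  · simp [hP, h G hP]
  · simp only [hP, if_false]
    split_ifs <;> positivity

lemma grProb_or_le {n : ℕ} {p : ℝ} (h0 : 0 ≤ p) (h1 : p ≤ 1)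
    (P Q : SimpleGraph (Fin n) → Prop) :
    grProb n p (fun G => P G ∨ Q G) ≤ grProb n p P + grProb n p Q := by
  have : 0 ≤ 1 - p := by linarith
  rw [grProb, grProb, grProb, ← Finset.sum_add_distrib]
  refine Finset.sum_le_sum fun G _ => ?_
  have : 0 ≤ p ^ G.edgeSet.ncard * (1 - p) ^ (n.choose 2 - G.edgeSet.ncard) := by positivity
  by_cases hP : P G <;> by_cases hQ : Q G <;> simp [hP, hQ, this]

lemma grProb_exists_le {n : ℕ} {p : ℝ} (h0 : 0 ≤ p) (h1 : p ≤ 1) {ι : Type*} (s : Finset ι)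
    (P : ι → SimpleGraph (Fin n) → Prop) :
    grProb n p (fun G => ∃ i ∈ s, P i G) ≤ ∑ i ∈ s, grProb n p (P i) := by
  classical
  induction s using Finset.induction_on with
  | empty => simp [grProb]
  | insert a s ha ih =>
    rw [Finset.sum_insert ha]
    refine le_trans (le_trans (grProb_mono h0 h1 fun G hG => ?_)
      (grProb_or_le h0 h1 (P a) fun G => ∃ i ∈ s, P i G)) (by gcongr)
    simpa using hG

lemma grProb_subset_le {n : ℕ} {p : ℝ} (h0 : 0 ≤ p) (h1 : p ≤ 1) (E : Finset (Sym2 (Fin n))) :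
    grProb n p (fun G => (E : Set (Sym2 (Fin n))) ⊆ G.edgeSet) ≤ p ^ E.card := by
  classical
  have h1' : 0 ≤ 1 - p := by linarith
  set T : Finset (Sym2 (Fin n)) := (⊤ : SimpleGraph (Fin n)).edgeFinset with hT
  have hTcard : T.card = n.choose 2 := by
    rw [hT, card_edgeFinset_top_eq_card_choose_two, Fintype.card_fin]
  have hsub : ∀ G : SimpleGraph (Fin n), G.edgeFinset ⊆ T := fun G => by
    rw [hT, edgeFinset_subset_edgeFinset]
    exact le_top
  have hncard : ∀ G : SimpleGraph (Fin n), G.edgeSet.ncard = G.edgeFinset.card := fun G => by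
    rw [Set.ncard_eq_toFinset_card', edgeFinset]
  rw [grProb, ← Finset.sum_filter]
  set 𝒢 := Finset.univ.filter fun G : SimpleGraph (Fin n) =>
    (E : Set (Sym2 (Fin n))) ⊆ G.edgeSet with h𝒢
  have hmem : ∀ {G}, G ∈ 𝒢 → E ⊆ G.edgeFinset := by
    intro G hG e he
    rw [h𝒢, Finset.mem_filter] at hG
    simpa using hG.2 he
  have hinj : Set.InjOn (fun G : SimpleGraph (Fin n) => G.edgeFinset \ E) 𝒢 := by
    intro G hG G' hG' h
    rw [← edgeFinset_inj, ← Finset.sdiff_union_of_subset (hmem hG),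
      ← Finset.sdiff_union_of_subset (hmem hG')]
    exact congrArg (· ∪ E) h
  calc ∑ G ∈ 𝒢, p ^ G.edgeSet.ncard * (1 - p) ^ (n.choose 2 - G.edgeSet.ncard)
      = ∑ G ∈ 𝒢, p ^ E.card * (p ^ (G.edgeFinset \ E).card *
          (1 - p) ^ ((T \ E).card - (G.edgeFinset \ E).card)) := by
        refine Finset.sum_congr rfl fun G hG => ?_
        have hE := hmem hG
        have h2 := Finset.card_le_card hE
        have h3 := Finset.card_le_card (hsub G)
        rw [hncard, Finset.card_sdiff_of_subset hE,
          Finset.card_sdiff_of_subset (hE.trans (hsub G)), hTcard, ← mul_assoc, ← pow_add]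
        congr 2 <;> omega
    _ = p ^ E.card * ∑ s ∈ 𝒢.image (fun G => G.edgeFinset \ E),
          p ^ s.card * (1 - p) ^ ((T \ E).card - s.card) := by
        rw [Finset.sum_image hinj, Finset.mul_sum]
    _ ≤ p ^ E.card * ∑ s ∈ (T \ E).powerset, p ^ s.card * (1 - p) ^ ((T \ E).card - s.card) := by
        gcongr
        intro s hs
        obtain ⟨G, -, rfl⟩ := Finset.mem_image.1 hs
        exact Finset.mem_powerset.2 (Finset.sdiff_subset_sdiff (hsub G) le_rfl)
    _ = p ^ E.card := by
        rw [Finset.sum_pow_mul_eq_add_pow]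
        simp

end Probability
section Exploration

variable {V : Type*} [Fintype V] {H : SimpleGraph V} {n : ℕ}

open Classical in
lemma sum_inv_pow_overlap_le (E : Finset (Sym2 (Fin n))) :
    ∑ f : V → Fin n, ((n : ℝ)⁻¹) ^ (Fintype.card V - overlap E f) ≤
      ((endpoints E).card + 1 : ℝ) ^ Fintype.card V := by
  classical
  set g : Fin n → ℝ := fun u => if u ∈ endpoints E then 1 else (n : ℝ)⁻¹ with hg
  have hprod : ∀ f : V → Fin n,
      ((n : ℝ)⁻¹) ^ (Fintype.card V - overlap E f) = ∏ x, g (f x) := by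
    intro f
    rw [hg, Finset.prod_ite, Finset.prod_const_one, one_mul, Finset.prod_const]
    congr 1
    refine (Nat.eq_sub_of_add_eq' ?_).symm
    rw [overlap, ← Finset.card_univ]
    convert Finset.card_filter_add_card_filter_not _
  have hsum : ∑ u, g u ≤ (endpoints E).card + 1 := by
    rw [hg, Finset.sum_ite, Finset.sum_const, Finset.sum_const, nsmul_eq_mul, nsmul_eq_mul,
      mul_one]
    gcongr
    · simp
    · rw [← div_eq_mul_inv]
      refine div_le_one_of_le₀ ?_ (by positivity)
      exact_mod_cast (Finset.card_le_univ _).trans_eq (Fintype.card_fin n)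
  have hpos : 0 ≤ ∑ u, g u := Finset.sum_nonneg fun u _ => by
    simp only [hg]
    split_ifs <;> positivity
  calc ∑ f : V → Fin n, ((n : ℝ)⁻¹) ^ (Fintype.card V - overlap E f)
      = ∑ f : V → Fin n, ∏ x, g (f x) := Finset.sum_congr rfl fun f _ => hprod f
    _ = ∏ _x : V, ∑ u, g u := by
        rw [Finset.prod_univ_sum, Fintype.piFinset_univ]
    _ = (∑ u, g u) ^ Fintype.card V := by rw [Finset.prod_const, Finset.card_univ]
    _ ≤ _ := by gcongr

lemma card_filter_apply_eq_le [DecidableEq V] {x y : V} (hxy : x ≠ y) (a b : Fin n) :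
    (Finset.univ.filter fun f : V → Fin n => f x = a ∧ f y = b).card ≤
      n ^ (Fintype.card V - 2) := by
  classical
  let t : V → Finset (Fin n) := fun z =>
    if z = x then {a} else if z = y then {b} else Finset.univ
  calc (Finset.univ.filter fun f : V → Fin n => f x = a ∧ f y = b).card
      ≤ (Fintype.piFinset t).card := by
        refine Finset.card_le_card fun f hf => Fintype.mem_piFinset.2 fun z => ?_
        simp only [Finset.mem_filter, Finset.mem_univ, true_and] at hf
        simp only [t]
        split_ifs with h1 h2
        · simp [h1, hf.1]
        · simp [h2, hf.2]
        · simp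
    _ = ∏ z ∈ ({x, y} : Finset V)ᶜ, n := by
        rw [Fintype.card_piFinset,
          ← Finset.prod_mul_prod_compl ({x, y} : Finset V) fun z => (t z).card,
          Finset.prod_pair hxy]
        simp only [t, if_pos, if_neg hxy.symm, Finset.card_singleton, one_mul]
        refine Finset.prod_congr rfl fun z hz => ?_
        simp only [Finset.mem_compl, Finset.mem_insert, Finset.mem_singleton, not_or] at hz
        simp [hz.1, hz.2]
    _ = n ^ (Fintype.card V - 2) := by
        rw [Finset.prod_const, Finset.card_compl, Finset.card_pair hxy]

open Classical in
lemma card_copies_through_le (e : Sym2 (Fin n)) :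
    (Finset.univ.filter fun f : V ↪ Fin n => e ∈ copyEdges H f).card ≤
      Fintype.card V ^ 2 * n ^ (Fintype.card V - 2) := by
  induction e with
  | _ a b =>
    calc (Finset.univ.filter fun f : V ↪ Fin n => s(a, b) ∈ copyEdges H f).card
        = ((Finset.univ.filter fun f : V ↪ Fin n => s(a, b) ∈ copyEdges H f).image
            fun f : V ↪ Fin n => (f : V → Fin n)).card :=
          (Finset.card_image_of_injective _ DFunLike.coe_injective).symm
      _ ≤ ((Finset.univ : Finset V).offDiag.biUnion fun z =>
            Finset.univ.filter fun f : V → Fin n => f z.1 = a ∧ f z.2 = b).card := by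
          refine Finset.card_le_card fun g hg => ?_
          obtain ⟨f, hf, rfl⟩ := Finset.mem_image.1 hg
          obtain ⟨d, hd, hdf⟩ := mem_copyEdges.1 (Finset.mem_filter.1 hf).2
          induction d with
          | _ x y =>
            have hxy : x ≠ y := H.ne_of_adj hd
            rw [Sym2.map_mk, Sym2.eq_iff] at hdf
            simp only [Finset.mem_biUnion, Finset.mem_offDiag, Finset.mem_univ, true_and,
              Finset.mem_filter, Prod.exists]
            rcases hdf with h | h
            · exact ⟨x, y, hxy, h⟩
            · exact ⟨y, x, hxy.symm, h.2, h.1⟩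
      _ ≤ (Finset.univ : Finset V).offDiag.card * n ^ (Fintype.card V - 2) :=
          Finset.card_biUnion_le_card_mul _ _ _ fun z hz =>
            card_filter_apply_eq_le (Finset.mem_offDiag.1 hz).2.2 a b
      _ ≤ _ := by
          gcongr
          rw [Finset.offDiag_card, Finset.card_univ, sq]
          exact Nat.sub_le _ _

/-- The potential of a partially explored edge set `E` with a queue of length `q`. -/
noncomputable def potential (H : SimpleGraph V) (c : ℝ) (E : Finset (Sym2 (Fin n))) (q : ℕ) : ℝ :=
  c ^ E.card * ((n : ℝ)⁻¹) ^ (endpoints E).card * 2 ^ q *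
    (2 ^ Fintype.card V) ^ ((endpoints E).card * (slack H E + 1).toNat)

lemma potential_nonneg {c : ℝ} (hc : 0 ≤ c) (E : Finset (Sym2 (Fin n))) (q : ℕ) :
    0 ≤ potential H c E q := by
  unfold potential
  positivity

/-- The factor lost when a copy is attached. -/
noncomputable def attachCost (H : SimpleGraph V) (K : ℤ) : ℝ :=
  2 ^ H.edgeSet.ncard * (2 ^ Fintype.card V) ^ (Fintype.card V * (K + 1).toNat)

lemma potential_attach_le (hbal : StrictlyTwoBalanced H) (h5 : 5 ≤ H.edgeSet.ncard) {c : ℝ}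
    (hc : 0 < c) (hc1 : c ≤ 1) {E : Finset (Sym2 (Fin n))} {K : ℤ} (h0 : 0 ≤ slack H E)
    (hK : slack H E ≤ K) {f : V ↪ Fin n} (hmeet : ∃ e ∈ E, e ∈ copyEdges H f)
    (hnot : ¬ copyEdges H f ⊆ E) (q : ℕ) :
    potential H c (E ∪ copyEdges H f) (q + H.edgeSet.ncard) ≤
      c * attachCost H K * potential H c E q *
        (((n : ℝ)⁻¹) ^ (Fintype.card V - 2) + ((n : ℝ)⁻¹) ^ (Fintype.card V - overlap E f) *
          ((2 ^ Fintype.card V) ^ (endpoints E).card)⁻¹) := by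
  obtain ⟨hj2, hle, hlt⟩ := slack_union_copyEdges hbal h5 hmeet hnot
  have hU := card_endpoints_union hbal h5 E f
  have hov : overlap E f ≤ Fintype.card V := Finset.card_le_univ _
  set ν := Fintype.card V
  set U := (endpoints E).card
  set U' := (endpoints (E ∪ copyEdges H f)).card
  set τ := (slack H E + 1).toNat
  set τ' := (slack H (E ∪ copyEdges H f) + 1).toNat
  have hB : (1 : ℝ) ≤ 2 ^ ν := one_le_pow₀ (by norm_num)
  have hcE : c ^ (E ∪ copyEdges H f).card ≤ c * c ^ E.card := by
    rw [← pow_succ']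
    refine pow_le_pow_of_le_one hc.le hc1 (Finset.card_lt_card ?_)
    exact Finset.ssubset_iff_subset_ne.2 ⟨Finset.subset_union_left, fun h =>
      hnot (Finset.union_eq_left.1 h.symm)⟩
  have hτK : τ ≤ (K + 1).toNat := Int.toNat_le_toNat (by omega)
  have hτ' : τ' ≤ τ := Int.toNat_le_toNat (by omega)
  have hUn : ((n : ℝ)⁻¹) ^ U' = ((n : ℝ)⁻¹) ^ U * ((n : ℝ)⁻¹) ^ (ν - overlap E f) := by
    rw [← pow_add]
    congr 1
    omega
  have key : ((2 : ℝ) ^ ν) ^ (U' * τ') * ((n : ℝ)⁻¹) ^ (ν - overlap E f) ≤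
      (2 ^ ν) ^ (ν * (K + 1).toNat) * (2 ^ ν) ^ (U * τ) *
        (((n : ℝ)⁻¹) ^ (ν - 2) + ((n : ℝ)⁻¹) ^ (ν - overlap E f) * ((2 ^ ν) ^ U)⁻¹) := by
    have hU' : U' ≤ U + ν := by omega
    rcases hj2.eq_or_lt with hj | hj
    · rw [← hj]
      have h1 : ((2 : ℝ) ^ ν) ^ (U' * τ') ≤ (2 ^ ν) ^ (ν * (K + 1).toNat) * (2 ^ ν) ^ (U * τ) := by
        rw [← pow_add]
        refine pow_le_pow_right₀ hB ?_
        calc U' * τ' ≤ (U + ν) * τ := Nat.mul_le_mul hU' hτ'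
          _ = ν * τ + U * τ := by ring
          _ ≤ _ := by gcongr
      refine mul_le_mul h1 ?_ (by positivity) (by positivity)
      have : (0 : ℝ) ≤ ((n : ℝ)⁻¹) ^ (ν - 2) * ((2 ^ ν) ^ U)⁻¹ := by positivity
      linarith
    · have hs := hlt hj
      have hττ : τ' + 1 ≤ τ := by omega
      have h1 : ((2 : ℝ) ^ ν) ^ (U' * τ') ≤
          (2 ^ ν) ^ (ν * (K + 1).toNat) * (2 ^ ν) ^ (U * τ) * ((2 ^ ν) ^ U)⁻¹ := by
        rw [← div_eq_mul_inv, le_div_iff₀ (by positivity), ← pow_add, ← pow_add]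
        refine pow_le_pow_right₀ hB ?_
        calc U' * τ' + U ≤ (U + ν) * τ' + U := by gcongr
          _ = ν * τ' + U * (τ' + 1) := by ring
          _ ≤ _ := by gcongr; exact hτ'.trans hτK
      calc ((2 : ℝ) ^ ν) ^ (U' * τ') * ((n : ℝ)⁻¹) ^ (ν - overlap E f)
          ≤ (2 ^ ν) ^ (ν * (K + 1).toNat) * (2 ^ ν) ^ (U * τ) * ((2 ^ ν) ^ U)⁻¹ *
            ((n : ℝ)⁻¹) ^ (ν - overlap E f) := by gcongr
        _ = (2 ^ ν) ^ (ν * (K + 1).toNat) * (2 ^ ν) ^ (U * τ) *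
            (((n : ℝ)⁻¹) ^ (ν - overlap E f) * ((2 ^ ν) ^ U)⁻¹) := by ring
        _ ≤ _ := by
          gcongr
          exact le_add_of_nonneg_left (by positivity)
  calc potential H c (E ∪ copyEdges H f) (q + H.edgeSet.ncard)
      = c ^ (E ∪ copyEdges H f).card * (((n : ℝ)⁻¹) ^ U * 2 ^ q * 2 ^ H.edgeSet.ncard) *
        ((2 ^ ν) ^ (U' * τ') * ((n : ℝ)⁻¹) ^ (ν - overlap E f)) := by
        change c ^ (E ∪ copyEdges H f).card * ((n : ℝ)⁻¹) ^ U' * 2 ^ (q + H.edgeSet.ncard) *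
          (2 ^ ν) ^ (U' * τ') = _
        rw [hUn, pow_add]
        ring
    _ ≤ c * c ^ E.card * (((n : ℝ)⁻¹) ^ U * 2 ^ q * 2 ^ H.edgeSet.ncard) * _ :=
        mul_le_mul (by gcongr) key (by positivity) (by positivity)
    _ = _ := by
        change _ = c * (2 ^ H.edgeSet.ncard * (2 ^ ν) ^ (ν * (K + 1).toNat)) *
          (c ^ E.card * ((n : ℝ)⁻¹) ^ U * 2 ^ q * (2 ^ ν) ^ (U * τ)) * _
        ring

open Classical in
/-- The copies of `H` containing the edge `e` that are not contained in `E`. -/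
noncomputable def attachable (H : SimpleGraph V) (E : Finset (Sym2 (Fin n))) (e : Sym2 (Fin n)) :
    Finset (V ↪ Fin n) :=
  Finset.univ.filter fun f => e ∈ copyEdges H f ∧ ¬ copyEdges H f ⊆ E

lemma mem_attachable {E : Finset (Sym2 (Fin n))} {e : Sym2 (Fin n)} {f : V ↪ Fin n} :
    f ∈ attachable H E e ↔ e ∈ copyEdges H f ∧ ¬ copyEdges H f ⊆ E := by
  simp [attachable]

open Classical in
lemma sum_potential_attach_le (hbal : StrictlyTwoBalanced H) (h5 : 5 ≤ H.edgeSet.ncard) {c : ℝ}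
    (hc : 0 < c) (hc1 : c ≤ 1) {E : Finset (Sym2 (Fin n))} {K : ℤ} (h0 : 0 ≤ slack H E)
    (hK : slack H E ≤ K) {e : Sym2 (Fin n)} (he : e ∈ E) (q : ℕ) :
    ∑ f ∈ attachable H E e,
        potential H c (E ∪ copyEdges H f) (q + H.edgeSet.ncard) ≤
      c * attachCost H K * ((Fintype.card V : ℝ) ^ 2 + 1) * potential H c E q := by
  have hn : (0 : ℝ) < n := by
    have : 0 < n := by
      induction e with
      | _ a b => exact a.pos
    exact_mod_cast this
  set ν := Fintype.card V with hν
  have hpot := potential_nonneg (H := H) hc.le E q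
  have hcost : 0 ≤ attachCost H K := by
    unfold attachCost
    positivity
  classical
  have hreg : ∑ _f ∈ attachable H E e, ((n : ℝ)⁻¹) ^ (ν - 2) ≤ (ν : ℝ) ^ 2 := by
    have h1 : (attachable H E e).card ≤ ν ^ 2 * n ^ (ν - 2) :=
      (Finset.card_le_card (Finset.monotone_filter_right _ fun f _ h => h.1)).trans
        (card_copies_through_le (H := H) e)
    have h2 : ((attachable H E e).card : ℝ) ≤ (ν : ℝ) ^ 2 * (n : ℝ) ^ (ν - 2) := by exact_mod_cast h1
    rw [Finset.sum_const, nsmul_eq_mul, inv_pow, ← div_eq_mul_inv,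
      div_le_iff₀ (by positivity)]
    exact h2
  have hdeg : ∑ f ∈ attachable H E e, ((n : ℝ)⁻¹) ^ (ν - overlap E f) * ((2 ^ ν) ^ (endpoints E).card)⁻¹ ≤ 1 := by
    rw [← Finset.sum_mul, ← div_eq_mul_inv]
    refine div_le_one_of_le₀ ?_ (by positivity)
    calc ∑ f ∈ attachable H E e, ((n : ℝ)⁻¹) ^ (ν - overlap E f)
        = ∑ f ∈ (attachable H E e).image fun f : V ↪ Fin n => (f : V → Fin n),
            ((n : ℝ)⁻¹) ^ (ν - overlap E f) := by
          rw [Finset.sum_image fun f _ g _ h => DFunLike.coe_injective h]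
      _ ≤ ∑ f : V → Fin n, ((n : ℝ)⁻¹) ^ (ν - overlap E f) :=
          Finset.sum_le_sum_of_subset_of_nonneg (Finset.subset_univ _)
            fun _ _ _ => by positivity
      _ ≤ ((endpoints E).card + 1 : ℝ) ^ ν := sum_inv_pow_overlap_le E
      _ ≤ ((2 : ℝ) ^ (endpoints E).card) ^ ν := by
          gcongr
          exact_mod_cast Nat.lt_two_pow_self
      _ = (2 ^ ν) ^ (endpoints E).card := by rw [← pow_mul, ← pow_mul, mul_comm]
  calc _ ≤ ∑ f ∈ attachable H E e, c * attachCost H K * potential H c E q *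
        (((n : ℝ)⁻¹) ^ (ν - 2) + ((n : ℝ)⁻¹) ^ (ν - overlap E f) *
          ((2 ^ ν) ^ (endpoints E).card)⁻¹) := by
        refine Finset.sum_le_sum fun f hf => ?_
        obtain ⟨hfe, hfE⟩ := mem_attachable.1 hf
        exact potential_attach_le hbal h5 hc hc1 h0 hK ⟨e, he, hfe⟩ hfE q
    _ ≤ c * attachCost H K * potential H c E q * ((ν : ℝ) ^ 2 + 1) := by
        rw [← Finset.mul_sum, Finset.sum_add_distrib]
        gcongr
    _ = _ := by ring

/-- `G` contains a copy-connected graph of negative slack that extends `E`, all of whose copies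
of `H` meeting `E` are either contained in `E` or meet it only in edges of the queue `Q`. -/
def Extends (H : SimpleGraph V) (E : Finset (Sym2 (Fin n))) (Q : List (Sym2 (Fin n)))
    (G : SimpleGraph (Fin n)) : Prop :=
  ∃ F ≤ G, CopyConnected H F ∧
    (∃ E₀ : Finset (Sym2 (Fin n)), (E₀ : Set (Sym2 (Fin n))) = F.edgeSet ∧ slack H E₀ < 0) ∧
    (E : Set (Sym2 (Fin n))) ⊆ F.edgeSet ∧
    ∀ f : V ↪ Fin n, (copyEdges H f : Set (Sym2 (Fin n))) ⊆ F.edgeSet →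
      ∀ e ∈ E, e ∈ copyEdges H f → copyEdges H f ⊆ E ∨ e ∈ Q

lemma not_extends_nil {E : Finset (Sym2 (Fin n))} (hE : E.Nonempty) (h0 : 0 ≤ slack H E)
    (G : SimpleGraph (Fin n)) : ¬ Extends H E [] G := by
  rintro ⟨F, -, hF, ⟨E₀, hE₀, hs⟩, hEF, hQ⟩
  by_cases h : (E : Set (Sym2 (Fin n))) = F.edgeSet
  · rw [← h, Finset.coe_inj] at hE₀
    subst hE₀
    omega
  · obtain ⟨f, hfF, ⟨e, he, hef⟩, hnot⟩ := hF E hE (hEF.ssubset_of_ne h)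
    rcases hQ f hfF e he hef with h | h
    · exact hnot h
    · simp at h

open Classical in
lemma Extends.pop_or_attach {E : Finset (Sym2 (Fin n))} {e : Sym2 (Fin n)}
    {Q : List (Sym2 (Fin n))} {G : SimpleGraph (Fin n)} (h : Extends H E (e :: Q) G) :
    Extends H E Q G ∨
      ∃ f ∈ attachable H E e,
        Extends H (E ∪ copyEdges H f) (e :: Q ++ (copyEdges H f).toList) G := by
  obtain ⟨F, hFG, hF, hE₀, hEF, hQ⟩ := h
  by_cases hex : ∃ f : V ↪ Fin n, (copyEdges H f : Set (Sym2 (Fin n))) ⊆ F.edgeSet ∧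
      e ∈ copyEdges H f ∧ ¬ copyEdges H f ⊆ E
  · obtain ⟨f, hfF, hef, hfE⟩ := hex
    refine Or.inr ⟨f, mem_attachable.2 ⟨hef, hfE⟩, F, hFG, hF, hE₀,
      by simpa using ⟨hEF, hfF⟩, fun g hgF d hd hdg => ?_⟩
    rcases Finset.mem_union.1 hd with hd | hd
    · rcases hQ g hgF d hd hdg with h | h
      · exact Or.inl (h.trans Finset.subset_union_left)
      · exact Or.inr (List.mem_append_left _ h)
    · exact Or.inr (List.mem_append_right _ (Finset.mem_toList.2 hd))
  · push Not at hex
    refine Or.inl ⟨F, hFG, hF, hE₀, hEF, fun f hfF d hd hdf => ?_⟩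
    rcases hQ f hfF d hd hdf with h | h
    · exact Or.inl h
    · rcases List.mem_cons.1 h with rfl | h
      · exact Or.inl (hex f hfF hdf)
      · exact Or.inr h

lemma grProb_extends_le (hbal : StrictlyTwoBalanced H) (h5 : 5 ≤ H.edgeSet.ncard) {c δ p : ℝ}
    {K : ℤ} (hc : 0 < c) (hc1 : c ≤ 1)
    (hcK : c * attachCost H K * ((Fintype.card V : ℝ) ^ 2 + 1) ≤ 1 / 2) (hδ : 0 ≤ δ)
    (hp0 : 0 ≤ p) (hp1 : p ≤ 1)
    (hp : ∀ E : Finset (Sym2 (Fin n)), slack H E < 0 →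
      p ^ E.card ≤ δ * (c ^ E.card * ((n : ℝ)⁻¹) ^ (endpoints E).card))
    (E : Finset (Sym2 (Fin n))) (Q : List (Sym2 (Fin n))) (hE : E.Nonempty)
    (hK : slack H E ≤ K) (hQ : ∀ e ∈ Q, e ∈ E) :
    grProb n p (Extends H E Q) ≤ δ * potential H c E Q.length := by
  classical
  induction hm : Fintype.card (Sym2 (Fin n)) - E.card using Nat.strong_induction_on
    generalizing E Q with
  | _ m ih =>
    rcases lt_or_ge (slack H E) 0 with hneg | h0
    · refine (grProb_mono hp0 hp1 (Q := fun G => (E : Set (Sym2 (Fin n))) ⊆ G.edgeSet) ?_).trans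
        ((grProb_subset_le hp0 hp1 E).trans ((hp E hneg).trans ?_))
      · rintro G ⟨F, hFG, -, -, hEF, -⟩
        exact hEF.trans (edgeSet_subset_edgeSet.2 hFG)
      · gcongr
        rw [potential, mul_assoc]
        refine le_mul_of_one_le_right (by positivity) ?_
        exact one_le_mul_of_one_le_of_one_le (one_le_pow₀ (by norm_num))
          (one_le_pow₀ (one_le_pow₀ (by norm_num)))
    · induction Q with
      | nil =>
        have : grProb n p (Extends H E []) = 0 := by
          simp [grProb, not_extends_nil hE h0]
        rw [this]
        exact mul_nonneg hδ (potential_nonneg hc.le _ _)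
      | cons e Q ihQ =>
        have heE : e ∈ E := hQ e (by simp)
        have hpop := ihQ fun d hd => hQ d (List.mem_cons_of_mem _ hd)
        have hattach : ∀ f ∈ attachable H E e,
            grProb n p (Extends H (E ∪ copyEdges H f) (e :: Q ++ (copyEdges H f).toList)) ≤
              δ * potential H c (E ∪ copyEdges H f) ((Q.length + 1) + H.edgeSet.ncard) := by
          intro f hf
          obtain ⟨hef, hfE⟩ := mem_attachable.1 hf
          have hlt : E.card < (E ∪ copyEdges H f).card := by
            refine Finset.card_lt_card (Finset.ssubset_iff_subset_ne.2
              ⟨Finset.subset_union_left, fun h => hfE (Finset.union_eq_left.1 h.symm)⟩)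
          have hle := Finset.card_le_univ (E ∪ copyEdges H f)
          have := ih _ (by omega) (E ∪ copyEdges H f) (e :: Q ++ (copyEdges H f).toList)
            (hE.mono Finset.subset_union_left)
            ((slack_union_copyEdges hbal h5 ⟨e, heE, hef⟩ hfE).2.1.trans hK) (by
              intro d hd
              rcases List.mem_append.1 hd with h | h
              · exact Finset.mem_union_left _ (hQ d h)
              · exact Finset.mem_union_right _ (Finset.mem_toList.1 h)) rfl
          rwa [List.length_append, List.length_cons, Finset.length_toList, card_copyEdges] at this
        have hhalf : potential H c E Q.length = potential H c E (Q.length + 1) / 2 := by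
          rw [potential, potential, pow_succ]
          ring
        have hpot := potential_nonneg (H := H) hc.le E (Q.length + 1)
        calc grProb n p (Extends H E (e :: Q))
            ≤ grProb n p (Extends H E Q) + ∑ f ∈ attachable H E e,
                grProb n p (Extends H (E ∪ copyEdges H f)
                  (e :: Q ++ (copyEdges H f).toList)) :=
              (grProb_mono hp0 hp1 fun G h => h.pop_or_attach).trans
                ((grProb_or_le hp0 hp1 _ _).trans (by
                  gcongr
                  exact grProb_exists_le hp0 hp1 _ _))
          _ ≤ δ * potential H c E Q.length + ∑ f ∈ attachable H E e,
                δ * potential H c (E ∪ copyEdges H f) ((Q.length + 1) + H.edgeSet.ncard) :=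
              add_le_add hpop (Finset.sum_le_sum hattach)
          _ ≤ δ * (potential H c E (Q.length + 1) / 2) +
                δ * (1 / 2 * potential H c E (Q.length + 1)) := by
              rw [hhalf, ← Finset.mul_sum]
              gcongr
              exact (sum_potential_attach_le hbal h5 hc hc1 h0 hK heE _).trans (by gcongr)
          _ = δ * potential H c E (e :: Q).length := by
              rw [List.length_cons]
              ring

end Exploration
section Threshold

variable {V : Type*} [Fintype V] {H : SimpleGraph V} {n : ℕ}

lemma one_le_attachCost (H : SimpleGraph V) (K : ℤ) : 1 ≤ attachCost H K :=
  one_le_mul_of_one_le_of_one_le (one_le_pow₀ (by norm_num))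
    (one_le_pow₀ (one_le_pow₀ (by norm_num)))

lemma pow_card_le_of_slack_neg (h5 : 5 ≤ H.edgeSet.ncard) {c p N : ℝ} (hc : 0 ≤ c)
    (hp0 : 0 ≤ p) (hN : 1 ≤ N) (hNn : N ^ (H.edgeSet.ncard - 1) = n)
    (hp : p ≤ c * (N ^ (Fintype.card V - 2))⁻¹) (E : Finset (Sym2 (Fin n)))
    (hE : slack H E < 0) :
    p ^ E.card ≤ N⁻¹ * (c ^ E.card * ((n : ℝ)⁻¹) ^ (endpoints E).card) := by
  have h4 := four_le_card h5
  have hexp : (H.edgeSet.ncard - 1) * (endpoints E).card + 1 ≤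
      (Fintype.card V - 2) * E.card := by
    unfold slack at hE
    zify [show 1 ≤ H.edgeSet.ncard by omega, show 2 ≤ Fintype.card V by omega]
    linarith
  calc p ^ E.card ≤ (c * (N ^ (Fintype.card V - 2))⁻¹) ^ E.card := by gcongr
    _ = c ^ E.card * (N ^ ((Fintype.card V - 2) * E.card))⁻¹ := by
        rw [mul_pow, inv_pow, pow_mul]
    _ ≤ c ^ E.card * (N ^ ((H.edgeSet.ncard - 1) * (endpoints E).card + 1))⁻¹ := by gcongr
    _ = _ := by
        rw [← hNn, pow_succ, pow_mul, mul_inv, inv_pow]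
        ring

lemma AntiRamsey.exists_extends (hbal : StrictlyTwoBalanced H) (h5 : 5 ≤ H.edgeSet.ncard)
    (hcol : ∀ F : SimpleGraph (Fin n), maxDensity F ≤ twoDensity H → ¬ AntiRamsey F H)
    {G : SimpleGraph (Fin n)} (hG : AntiRamsey G H) :
    ∃ f : V ↪ Fin n, Extends H (copyEdges H f) (copyEdges H f).toList G := by
  obtain ⟨F, hFG, hFA, hF⟩ := hG.exists_copyConnected
  have hd : twoDensity H < maxDensity F := not_le.1 fun h => hcol F h hFA
  obtain ⟨f, hf, -⟩ := hFA (Sym2 (Fin n)) id fun _ _ _ _ hne _ => hne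
  exact ⟨f, F, hFG, hF, hF.exists_slack_neg hbal h5 hd, copyEdges_subset_iff.2 hf,
    fun g _ e he _ => Or.inr (Finset.mem_toList.2 he)⟩

lemma grProb_antiRamsey_le (hbal : StrictlyTwoBalanced H) (h5 : 5 ≤ H.edgeSet.ncard)
    (hcol : ∀ F : SimpleGraph (Fin n), maxDensity F ≤ twoDensity H → ¬ AntiRamsey F H)
    {c δ p : ℝ} {K : ℤ} (hK : K = 2 * H.edgeSet.ncard - Fintype.card V)
    (hc : 0 < c) (hc1 : c ≤ 1)
    (hcK : c * attachCost H K * ((Fintype.card V : ℝ) ^ 2 + 1) ≤ 1 / 2) (hδ : 0 ≤ δ)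
    (hp0 : 0 ≤ p) (hp1 : p ≤ 1) (hn : 0 < n)
    (hp : ∀ E : Finset (Sym2 (Fin n)), slack H E < 0 →
      p ^ E.card ≤ δ * (c ^ E.card * ((n : ℝ)⁻¹) ^ (endpoints E).card)) :
    grProb n p (fun G => AntiRamsey G H) ≤ attachCost H K * δ := by
  classical
  have hstart : ∀ f : V ↪ Fin n,
      grProb n p (Extends H (copyEdges H f) (copyEdges H f).toList) ≤
        δ * (attachCost H K * ((n : ℝ)⁻¹) ^ Fintype.card V) := by
    intro f
    have hV : (endpoints (copyEdges H f)).card = Fintype.card V := by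
      rw [endpoints_copyEdges hbal h5, Finset.card_map, Finset.card_univ]
    have hs : slack H (copyEdges H f) = K := by
      rw [slack, hV, card_copyEdges, hK]
      ring
    have hne : (copyEdges H f).Nonempty := by
      rw [← Finset.card_pos, card_copyEdges]
      omega
    refine (grProb_extends_le hbal h5 hc hc1 hcK hδ hp0 hp1 hp _ _ hne hs.le
      fun e he => Finset.mem_toList.1 he).trans ?_
    gcongr
    rw [potential, hs, hV, Finset.length_toList, card_copyEdges, attachCost]
    have h1 : c ^ H.edgeSet.ncard ≤ 1 := pow_le_one₀ hc.le hc1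
    set X : ℝ := 2 ^ H.edgeSet.ncard *
      (2 ^ Fintype.card V) ^ (Fintype.card V * (K + 1).toNat) * ((n : ℝ)⁻¹) ^ Fintype.card V
      with hX
    have hX0 : 0 ≤ X := by positivity
    calc _ = c ^ H.edgeSet.ncard * X := by rw [hX]; ring
      _ ≤ 1 * X := by gcongr
      _ = X := one_mul X
  have hcard : (Fintype.card (V ↪ Fin n) : ℝ) ≤ (n : ℝ) ^ Fintype.card V := by
    rw [Fintype.card_embedding_eq, Fintype.card_fin]
    exact_mod_cast Nat.descFactorial_le_pow n _
  have hn' : (n : ℝ) ≠ 0 := by exact_mod_cast hn.ne'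
  have hcost := one_le_attachCost H K
  calc grProb n p (fun G => AntiRamsey G H)
      ≤ grProb n p (fun G => ∃ f ∈ (Finset.univ : Finset (V ↪ Fin n)),
          Extends H (copyEdges H f) (copyEdges H f).toList G) :=
        grProb_mono hp0 hp1 fun G hG => by
          simpa using hG.exists_extends hbal h5 hcol
    _ ≤ ∑ f : V ↪ Fin n, grProb n p (Extends H (copyEdges H f) (copyEdges H f).toList) :=
        grProb_exists_le hp0 hp1 _ _
    _ ≤ ∑ _f : V ↪ Fin n, δ * (attachCost H K * ((n : ℝ)⁻¹) ^ Fintype.card V) :=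
        Finset.sum_le_sum fun f _ => hstart f
    _ = Fintype.card (V ↪ Fin n) * (δ * (attachCost H K * ((n : ℝ)⁻¹) ^ Fintype.card V)) := by
        rw [Finset.sum_const, nsmul_eq_mul, Finset.card_univ]
    _ ≤ (n : ℝ) ^ Fintype.card V * (δ * (attachCost H K * ((n : ℝ)⁻¹) ^ Fintype.card V)) := by
        gcongr
    _ = attachCost H K * δ := by
        rw [inv_pow]
        field_simp

end Threshold

/-- reduction of the anti-Ramsey 0-statement to a colouring statement. -/
theorem stmt_3 {V : Type} [Fintype V] (H : SimpleGraph V)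
    (hbal : StrictlyTwoBalanced H) (h5 : 5 ≤ H.edgeSet.ncard)
    (hm : 1 < twoDensity H)
    (hcol : ∀ (W : Type) [Fintype W] (G : SimpleGraph W),
      maxDensity G ≤ twoDensity H → ¬ AntiRamsey G H) :
    ∃ c : ℝ, 0 < c ∧ ∀ p : ℕ → ℝ, (∀ n, 0 ≤ p n ∧ p n ≤ 1) →
      (∀ n : ℕ, p n ≤ c * (n : ℝ) ^ (-(1 / twoDensity H))) →
      Tendsto (fun n => grProb n (p n) (fun G => AntiRamsey G H)) atTop (nhds 0) := by
  have h4 := four_le_card h5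
  set ε := H.edgeSet.ncard with hε
  set ν := Fintype.card V with hν
  have h4' : (4 : ℝ) ≤ ν := by exact_mod_cast h4
  have h5' : (5 : ℝ) ≤ ε := by exact_mod_cast h5
  set K : ℤ := 2 * ε - ν with hK
  have hcost := one_le_attachCost H K
  set D : ℝ := 2 * (attachCost H K * ((ν : ℝ) ^ 2 + 1)) with hD
  have hD1 : 1 ≤ D := by nlinarith [sq_nonneg (ν : ℝ)]
  refine ⟨D⁻¹, by positivity, fun p hp01 hp => ?_⟩
  have hlim : Tendsto (fun n : ℕ => attachCost H K * ((n : ℝ) ^ (1 / ((ε : ℝ) - 1)))⁻¹)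
      atTop (nhds 0) := by
    have hpos : 0 < 1 / ((ε : ℝ) - 1) := one_div_pos.2 (by linarith)
    simpa using (((tendsto_rpow_atTop hpos).comp tendsto_natCast_atTop_atTop).inv_tendsto_atTop
      ).const_mul (attachCost H K)
  refine tendsto_of_tendsto_of_tendsto_of_le_of_le' tendsto_const_nhds hlim
    (Eventually.of_forall fun n => grProb_nonneg (hp01 n).1 (hp01 n).2 _) ?_
  filter_upwards [eventually_gt_atTop 0] with n hn
  have hn1 : (1 : ℝ) ≤ n := by exact_mod_cast hn
  have hN1 : (1 : ℝ) ≤ (n : ℝ) ^ (1 / ((ε : ℝ) - 1)) :=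
    Real.one_le_rpow hn1 (one_div_nonneg.2 (by linarith))
  refine grProb_antiRamsey_le hbal h5 (fun F => hcol (Fin n) F) hK (inv_pos.2 (by positivity))
    (inv_le_one_of_one_le₀ hD1) ?_ (by positivity) (hp01 n).1 (hp01 n).2 hn
    (pow_card_le_of_slack_neg h5 (by positivity) (hp01 n).1 hN1 ?_ ?_)
  · rw [mul_assoc, inv_mul_le_iff₀ (by positivity), hD]
    linarith
  · rw [← Real.rpow_mul_natCast (by positivity), Nat.cast_sub (by omega), Nat.cast_one,
      one_div_mul_cancel (by linarith), Real.rpow_one]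
  · refine (hp n).trans_eq ?_
    rw [twoDensity_eq hbal h5, ← Real.rpow_mul_natCast (by positivity),
      Nat.cast_sub (by omega), Nat.cast_ofNat, Real.rpow_neg (by positivity), one_div_div,
      one_div_mul_eq_div]
end

section
/- Let H be a strictly 2-balanced graph with at least five edges and m_2(H) > 1. Then for any two distinct edges e, f of H, the graph obtained from H by deleting e and f still contains two edges which are vertex-disjoint from each other. -/
open SimpleGraph Filter

/-- A strictly 2-balanced graph with an edge has larger `d₂` than any set of at least `k` edges
inside a proper vertex subset `S` with at least three vertices. -/
lemma StrictlyTwoBalanced.mul_lt_mul_of_ne_univ {V : Type*} [Fintype V] {H : SimpleGraph V}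
    (hbal : StrictlyTwoBalanced H) (he : 1 ≤ H.edgeSet.ncard) {S : Set V} (hS : S ≠ Set.univ)
    (hS3 : 3 ≤ S.ncard) {E : Set (Sym2 V)} (hE : E ⊆ H.edgeSet) (hES : ∀ g ∈ E, ∀ x ∈ g, x ∈ S)
    {k : ℕ} (hk1 : 1 ≤ k) (hk : k ≤ E.ncard) :
    ((k : ℝ) - 1) * ((Nat.card V : ℝ) - 2) <
      ((H.edgeSet.ncard : ℝ) - 1) * ((S.ncard : ℝ) - 2) := by
  set J : H.Subgraph := (⊤ : H.Subgraph).induce S with hJ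
  have hJtop : J ≠ ⊤ := fun h => hS (by
    have := congrArg Subgraph.verts h
    simpa [hJ] using this)
  have hsub : E ⊆ J.edgeSet := by
    intro g hg
    have hgH := hE hg
    have hgS := hES g hg
    induction g using Sym2.ind with
    | h x y =>
      rw [mem_edgeSet] at hgH
      simp only [hJ, Subgraph.mem_edgeSet, Subgraph.induce_adj, Subgraph.top_adj]
      exact ⟨hgS x (by simp), hgS y (by simp), hgH⟩
  have hkJ : k ≤ J.edgeSet.ncard := hk.trans (Set.ncard_le_ncard hsub (Set.toFinite _))
  have hSV : S.ncard ≤ Nat.card V := by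
    rw [← Set.ncard_univ]
    exact Set.ncard_le_ncard (Set.subset_univ _) (Set.toFinite _)
  have h := hbal J hJtop
  have hv : J.verts = S := by simp [hJ]
  rw [hv, d2val, d2val, if_pos ⟨hk1.trans hkJ, hS3⟩, if_pos ⟨he, hS3.trans hSV⟩] at h
  have h3 : (3 : ℝ) ≤ S.ncard := by exact_mod_cast hS3
  have h4 : (S.ncard : ℝ) ≤ Nat.card V := by exact_mod_cast hSV
  have h5 : (k : ℝ) ≤ J.edgeSet.ncard := by exact_mod_cast hkJ
  rw [div_lt_div_iff₀ (by linarith) (by linarith)] at h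
  refine lt_of_le_of_lt ?_ h
  exact mul_le_mul_of_nonneg_right (by linarith) (by linarith)

lemma StrictlyTwoBalanced.twoDensity_le {V : Type*} {H : SimpleGraph V}
    (hbal : StrictlyTwoBalanced H) :
    twoDensity H ≤ d2val H.edgeSet.ncard (Nat.card V) := by
  refine csSup_le ⟨_, ⊤, rfl⟩ ?_
  rintro x ⟨J, rfl⟩
  by_cases hJ : J = ⊤
  · subst hJ
    simp [Set.ncard_univ]
  · exact (hbal J hJ).le

lemma SimpleGraph.four_le_card_of_five_le_ncard_edgeSet {V : Type*} [Fintype V]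
    {H : SimpleGraph V} (h5 : 5 ≤ H.edgeSet.ncard) : 4 ≤ Nat.card V := by
  classical
  have h := H.card_edgeFinset_le_card_choose_two
  rw [← coe_edgeFinset, Set.ncard_coe_finset] at h5
  rw [Nat.card_eq_fintype_card]
  by_contra! hlt
  have : (Fintype.card V).choose 2 ≤ (3 : ℕ).choose 2 :=
    Nat.choose_le_choose 2 (by omega)
  simp [Nat.choose] at this
  omega

/-- In a strictly 2-balanced graph with `m₂ > 1`, no vertex has degree one. -/
lemma StrictlyTwoBalanced.exists_adj_ne {V : Type*} [Fintype V] {H : SimpleGraph V}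
    (hbal : StrictlyTwoBalanced H) (h5 : 5 ≤ H.edgeSet.ncard)
    (hlt : Nat.card V ≤ H.edgeSet.ncard) (u c : V) : ∃ x, x ≠ c ∧ H.Adj u x := by
  by_contra! hno
  have hv := four_le_card_of_five_le_ncard_edgeSet h5
  have hcard : ({u}ᶜ : Set V).ncard = Nat.card V - 1 := by
    rw [Set.ncard_compl, Set.ncard_singleton]
  have hk : H.edgeSet.ncard - 1 ≤ (H.edgeSet \ {s(u, c)}).ncard := by
    have := Set.le_ncard_sdiff {s(u, c)} H.edgeSet
    rwa [Set.ncard_singleton] at this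
  have h := hbal.mul_lt_mul_of_ne_univ (S := {u}ᶜ) (by omega) (by simp) (by omega)
    (E := H.edgeSet \ {s(u, c)}) Set.sdiff_subset ?_ (by omega) hk
  · rw [hcard, Nat.cast_sub (by omega), Nat.cast_sub (by omega)] at h
    have : (Nat.card V : ℝ) ≤ H.edgeSet.ncard := by exact_mod_cast hlt
    push_cast at h
    nlinarith
  · rintro g ⟨hg, hgc⟩ x hx hxu
    obtain rfl : x = u := hxu
    obtain ⟨y, rfl⟩ := Sym2.mem_iff_exists.1 hx
    have hyc : y = c := by
      by_contra hyc
      exact hno y hyc hg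
    exact hgc (by simp [hyc])

/-- A strictly 2-balanced graph with at most `v + 1` edges, and at least five, is triangle-free. -/
lemma StrictlyTwoBalanced.not_triangle {V : Type*} [Fintype V] {H : SimpleGraph V}
    (hbal : StrictlyTwoBalanced H) (h5 : 5 ≤ H.edgeSet.ncard)
    (hle : H.edgeSet.ncard ≤ Nat.card V + 1) {a b c : V} (hab : H.Adj a b) (hac : H.Adj a c)
    (hbc : H.Adj b c) : False := by
  have hv := four_le_card_of_five_le_ncard_edgeSet h5
  have hS : ({a, b, c} : Set V).ncard = 3 :=
    Set.ncard_eq_three.2 ⟨a, b, c, hab.ne, hac.ne, hbc.ne, rfl⟩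
  have hE : ({s(a, b), s(a, c), s(b, c)} : Set (Sym2 V)).ncard = 3 := by
    refine Set.ncard_eq_three.2 ⟨_, _, _, ?_, ?_, ?_, rfl⟩ <;>
      simp [hab.ne, hac.ne, hbc.ne, hab.ne', hbc.ne']
  have h := hbal.mul_lt_mul_of_ne_univ (S := {a, b, c}) (by omega)
    (by intro h; rw [h, Set.ncard_univ] at hS; omega) hS.ge
    (E := {s(a, b), s(a, c), s(b, c)}) (k := 3) ?_ ?_ (by omega) hE.ge
  · rw [hS] at h
    have h1 : (H.edgeSet.ncard : ℝ) ≤ Nat.card V + 1 := by exact_mod_cast hle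
    have h2 : (4 : ℝ) ≤ Nat.card V := by exact_mod_cast hv
    push_cast at h
    linarith
  · rintro g (rfl | rfl | rfl) <;> assumption
  · rintro g (rfl | rfl | rfl) x hx <;> rcases Sym2.mem_iff.1 hx with rfl | rfl <;> simp

/-- Pairwise intersecting edges of a graph, at least two of them, form a star or lie in a
triangle. -/
lemma SimpleGraph.star_or_triangle_of_intersecting {V : Type*} {H : SimpleGraph V}
    {R : Set (Sym2 V)} (hR : R ⊆ H.edgeSet) (hR2 : R.Nontrivial)
    (hmeet : ∀ g ∈ R, ∀ g' ∈ R, ∃ v, v ∈ g ∧ v ∈ g') :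
    (∃ c, ∀ g ∈ R, c ∈ g) ∨
      ∃ a b c, H.Adj a b ∧ H.Adj a c ∧ H.Adj b c ∧ R ⊆ {s(a, b), s(a, c), s(b, c)} := by
  obtain ⟨g, hg, g', hg', hne⟩ := hR2
  obtain ⟨a, hag, hag'⟩ := hmeet g hg g' hg'
  obtain ⟨b, rfl⟩ := Sym2.mem_iff_exists.1 hag
  obtain ⟨c, rfl⟩ := Sym2.mem_iff_exists.1 hag'
  have hbc : b ≠ c := fun h => hne (by rw [h])
  have hab : H.Adj a b := hR hg
  have hac : H.Adj a c := hR hg'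
  by_cases hstar : ∀ k ∈ R, a ∈ k
  · exact Or.inl ⟨a, hstar⟩
  push Not at hstar
  obtain ⟨k, hk, hak⟩ := hstar
  have hkbc : k = s(b, c) := by
    obtain ⟨x, hx, hx'⟩ := hmeet k hk _ hg
    obtain ⟨y, hy, hy'⟩ := hmeet k hk _ hg'
    have hxb : x = b := (Sym2.mem_iff.1 hx').resolve_left (by rintro rfl; exact hak hx)
    have hyc : y = c := (Sym2.mem_iff.1 hy').resolve_left (by rintro rfl; exact hak hy)
    subst hxb hyc
    exact (Sym2.mem_and_mem_iff hbc).1 ⟨hx, hy⟩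
  subst hkbc
  refine Or.inr ⟨a, b, c, hab, hac, hR hk, fun g hgR => ?_⟩
  have h1 := hmeet g hgR _ hg
  have h2 := hmeet g hgR _ hg'
  have h3 := hmeet g hgR _ hk
  have := hab.ne
  have := hac.ne
  induction g using Sym2.ind with
  | h x y =>
    simp only [Sym2.mem_iff, Set.mem_insert_iff, Set.mem_singleton_iff, Sym2.eq_iff] at *
    grind

lemma SimpleGraph.ncard_add_one_le_of_star {V : Type*} [Fintype V] {H : SimpleGraph V}
    {R : Set (Sym2 V)} (hR : R ⊆ H.edgeSet) {c : V} (hc : ∀ g ∈ R, c ∈ g) :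
    R.ncard + 1 ≤ Nat.card V := by
  have hsub : R ⊆ (fun x => s(c, x)) '' ({c}ᶜ : Set V) := by
    intro g hg
    obtain ⟨x, rfl⟩ := Sym2.mem_iff_exists.1 (hc g hg)
    exact ⟨x, (H.ne_of_adj (hR hg)).symm, rfl⟩
  have h1 := Set.ncard_le_ncard hsub (Set.toFinite _)
  have h2 := Set.ncard_image_le (f := fun x => s(c, x)) (Set.toFinite ({c}ᶜ : Set V))
  have h3 := Set.ncard_add_ncard_compl ({c} : Set V)
  rw [Set.ncard_singleton] at h3
  omega

/-- removing any two edges from a strictly 2-balanced graph with at least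
five edges and `m₂ > 1` leaves two vertex-disjoint edges. -/
theorem stmt_5 {V : Type} [Fintype V] (H : SimpleGraph V)
    (hbal : StrictlyTwoBalanced H) (h5 : 5 ≤ H.edgeSet.ncard)
    (hm : 1 < twoDensity H) :
    ∀ e ∈ H.edgeSet, ∀ f ∈ H.edgeSet, e ≠ f →
      ∃ g₁ ∈ H.edgeSet, ∃ g₂ ∈ H.edgeSet, g₁ ≠ e ∧ g₁ ≠ f ∧ g₂ ≠ e ∧ g₂ ≠ f ∧
        ∀ v : V, v ∈ g₁ → v ∉ g₂ := by
  intro e he f hf hef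
  by_contra! hcon
  have hv := four_le_card_of_five_le_ncard_edgeSet h5
  have hlt : Nat.card V ≤ H.edgeSet.ncard := by
    have h := hm.trans_le hbal.twoDensity_le
    rw [d2val, if_pos ⟨by omega, by omega⟩] at h
    have h2 : (4 : ℝ) ≤ Nat.card V := by exact_mod_cast hv
    rw [one_lt_div (by linarith)] at h
    have h3 : (Nat.card V : ℝ) < H.edgeSet.ncard + 1 := by linarith
    have h4 : Nat.card V < H.edgeSet.ncard + 1 := by exact_mod_cast h3
    omega
  set R : Set (Sym2 V) := H.edgeSet \ {e, f} with hRdef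
  have hR : R ⊆ H.edgeSet := Set.sdiff_subset
  have hRcard : H.edgeSet.ncard = R.ncard + 2 := by
    have := Set.ncard_sdiff_add_ncard_of_subset
      (show ({e, f} : Set (Sym2 V)) ⊆ H.edgeSet by rintro g (rfl | rfl) <;> assumption)
      (Set.toFinite _)
    rw [Set.ncard_pair hef] at this
    exact this.symm
  have hmeet : ∀ g ∈ R, ∀ g' ∈ R, ∃ v, v ∈ g ∧ v ∈ g' := by
    rintro g ⟨hg, hg2⟩ g' ⟨hg', hg2'⟩
    simp only [Set.mem_insert_iff, Set.mem_singleton_iff, not_or] at hg2 hg2'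
    exact hcon g hg g' hg' hg2.1 hg2.2 hg2'.1 hg2'.2
  rcases star_or_triangle_of_intersecting hR
    (Set.one_lt_ncard_iff_nontrivial.1 (by omega)) hmeet with
    ⟨c, hc⟩ | ⟨a, b, c, hab, hac, hbc, hsub⟩
  · have hle := ncard_add_one_le_of_star hR hc
    have htri : ∀ {a b x y : V}, s(c, a) ∈ R → s(c, b) ∈ R → s(c, a) ≠ s(c, b) →
        H.Adj a x → s(a, x) = s(b, y) → False := by
      intro a b x y ha hb hab hax hxy
      have hne : a ≠ b := fun h => hab (by rw [h])
      obtain rfl : x = b := by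
        rcases Sym2.eq_iff.1 hxy with h | h
        · exact absurd h.1 hne
        · exact h.2
      exact hbal.not_triangle h5 (by omega) (hR ha) (hR hb) hax
    have hnbr : ∀ g ∈ R, ∃ a x, g = s(c, a) ∧ H.Adj a x ∧ (s(a, x) = e ∨ s(a, x) = f) := by
      intro g hg
      obtain ⟨a, rfl⟩ := Sym2.mem_iff_exists.1 (hc g hg)
      obtain ⟨x, hxc, hax⟩ := hbal.exists_adj_ne h5 hlt a c
      refine ⟨a, x, rfl, hax, ?_⟩
      by_contra hnot
      have hmem : s(a, x) ∈ R := ⟨hax, hnot⟩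
      rcases Sym2.mem_iff.1 (hc _ hmem) with h | h
      · exact H.ne_of_adj (hR hg) h
      · exact hxc h.symm
    obtain ⟨g₁, g₂, g₃, h₁, h₂, h₃, h12, h13, h23⟩ :=
      (Set.two_lt_ncard_iff (Set.toFinite R)).1 (by omega)
    obtain ⟨a₁, x₁, rfl, hx₁, hor₁⟩ := hnbr g₁ h₁
    obtain ⟨a₂, x₂, rfl, hx₂, hor₂⟩ := hnbr g₂ h₂
    obtain ⟨a₃, x₃, rfl, hx₃, hor₃⟩ := hnbr g₃ h₃
    have n12 : s(a₁, x₁) ≠ s(a₂, x₂) := htri h₁ h₂ h12 hx₁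
    have n13 : s(a₁, x₁) ≠ s(a₃, x₃) := htri h₁ h₃ h13 hx₁
    have n23 : s(a₂, x₂) ≠ s(a₃, x₃) := htri h₂ h₃ h23 hx₂
    grind
  · have h3 : R.ncard ≤ 3 := by
      refine (Set.ncard_le_ncard hsub (Set.toFinite _)).trans ?_
      exact (Set.ncard_insert_le _ _).trans (Nat.succ_le_succ (Set.ncard_insert_le _ _) |>.trans
        (by simp))
    exact hbal.not_triangle h5 (by omega) hab hac hbc
end

section
/- Let H be a strictly 2-balanced graph with 1 < m_2(H) < δ(H)(δ(H)+1)/(2δ(H)+1), where δ(H) denotes the minimum degree of H. Then every graph B with m(B) ≤ m_2(H) does not have the anti-Ramsey property for H; that is, B admits a proper edge-colouring containing no rainbow copy of H. -/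
open SimpleGraph Filter

/-- `χ` colours the edges of `B` inside `S` properly, with colours taken from the pairs inside `S`,
and without rainbow copies of `H` inside `S`. -/
def RainbowFreeOn {V W : Type*} (H : SimpleGraph W) (B : SimpleGraph V) (S : Finset V)
    (χ : Sym2 V → Sym2 V) : Prop :=
  (∀ e ∈ B.edgeSet, (∀ x ∈ e, x ∈ S) → ∀ x ∈ χ e, x ∈ S) ∧
  (∀ e ∈ B.edgeSet, ∀ e' ∈ B.edgeSet, (∀ x ∈ e, x ∈ S) → (∀ x ∈ e', x ∈ S) → e ≠ e' →
    (∃ v, v ∈ e ∧ v ∈ e') → χ e ≠ χ e') ∧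
  ∀ f : W ↪ V, GraphCopy H B f → (∀ w, f w ∈ S) →
    ∃ e ∈ H.edgeSet, ∃ e' ∈ H.edgeSet, e ≠ e' ∧ χ (Sym2.map f e) = χ (Sym2.map f e')

open Classical in
/-- A colouring of the edges touching `R` extends a rainbow-free colouring outside `R`. -/
lemma RainbowFreeOn.extend {V W : Type*} {H : SimpleGraph W} {B : SimpleGraph V} {S R : Finset V}
    {χ : Sym2 V → Sym2 V} (hχ : RainbowFreeOn H B (S \ R) χ) (ρ : Sym2 V → Sym2 V)
    (hρS : ∀ e ∈ B.edgeSet, (∀ x ∈ e, x ∈ S) → (∃ x ∈ e, x ∈ R) →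
      (∀ x ∈ ρ e, x ∈ S) ∧ ∃ x ∈ ρ e, x ∈ R)
    (hρ : ∀ e ∈ B.edgeSet, ∀ e' ∈ B.edgeSet, e ≠ e' → (∃ v, v ∈ e ∧ v ∈ e') → ρ e ≠ ρ e')
    (hcopy : ∀ f : W ↪ V, GraphCopy H B f → (∀ w, f w ∈ S) → (∃ w, f w ∈ R) →
      ∃ e ∈ H.edgeSet, ∃ e' ∈ H.edgeSet, e ≠ e' ∧ (∃ x ∈ Sym2.map f e, x ∈ R) ∧
        (∃ x ∈ Sym2.map f e', x ∈ R) ∧ ρ (Sym2.map f e) = ρ (Sym2.map f e')) :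
    ∃ χ', RainbowFreeOn H B S χ' := by
  obtain ⟨h1, h2, h3⟩ := hχ
  have hin : ∀ e : Sym2 V, (∀ x ∈ e, x ∈ S) → (¬ ∃ x ∈ e, x ∈ R) → ∀ x ∈ e, x ∈ S \ R :=
    fun e he hn x hx => Finset.mem_sdiff.2 ⟨he x hx, fun h => hn ⟨x, hx, h⟩⟩
  have hne : ∀ e ∈ B.edgeSet, ∀ e' ∈ B.edgeSet, (∀ x ∈ e, x ∈ S) → (∀ x ∈ e', x ∈ S) →
      (∃ x ∈ e, x ∈ R) → (¬ ∃ x ∈ e', x ∈ R) → ρ e ≠ χ e' := by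
    intro e he e' he' hS hS' hR hR' heq
    obtain ⟨x, hx, hxR⟩ := (hρS e he hS hR).2
    exact (Finset.mem_sdiff.1 (h1 e' he' (hin e' hS' hR') x (heq ▸ hx))).2 hxR
  refine ⟨fun e => if ∃ x ∈ e, x ∈ R then ρ e else χ e, ?_, ?_, ?_⟩
  · intro e he hS x hx
    by_cases hR : ∃ x ∈ e, x ∈ R
    · simp only [if_pos hR] at hx
      exact (hρS e he hS hR).1 x hx
    · simp only [if_neg hR] at hx
      exact (Finset.mem_sdiff.1 (h1 e he (hin e hS hR) x hx)).1
  · intro e he e' he' hS hS' hee hv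
    by_cases hR : ∃ x ∈ e, x ∈ R <;> by_cases hR' : ∃ x ∈ e', x ∈ R
    · simp only [if_pos hR, if_pos hR']
      exact hρ e he e' he' hee hv
    · simp only [if_pos hR, if_neg hR']
      exact hne e he e' he' hS hS' hR hR'
    · simp only [if_neg hR, if_pos hR']
      exact (hne e' he' e he hS' hS hR' hR).symm
    · simp only [if_neg hR, if_neg hR']
      exact h2 e he e' he' (hin e hS hR) (hin e' hS' hR') hee hv
  · intro f hf hS
    by_cases hR : ∃ w, f w ∈ R
    · obtain ⟨e, he, e', he', hee, hx, hx', hc⟩ := hcopy f hf hS hR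
      exact ⟨e, he, e', he', hee, by simp only [if_pos hx, if_pos hx', hc]⟩
    · obtain ⟨e, he, e', he', hee, hc⟩ :=
        h3 f hf fun w => Finset.mem_sdiff.2 ⟨hS w, fun h => hR ⟨w, h⟩⟩
      have hmap : ∀ e : Sym2 W, ¬ ∃ x ∈ Sym2.map f e, x ∈ R := by
        rintro e ⟨x, hx, hxR⟩
        obtain ⟨w, -, rfl⟩ := Sym2.mem_map.1 hx
        exact hR ⟨w, hxR⟩
      exact ⟨e, he, e', he', hee, by simp only [if_neg (hmap e), if_neg (hmap e'), hc]⟩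

open Classical in
/-- If the average degree inside `S` is small, then some vertex has small degree or two vertices
of degree `d` are adjacent. -/
lemma exists_adj_of_sum_card_lt {V : Type*} (B : SimpleGraph V) {d : ℕ} {S : Finset V}
    (hS : (2 * d + 1) * ∑ x ∈ S, (S.filter (B.Adj x)).card < 2 * (d * (d + 1)) * S.card)
    (hd : ∀ x ∈ S, d ≤ (S.filter (B.Adj x)).card) :
    ∃ u ∈ S, ∃ v ∈ S, B.Adj u v ∧ (S.filter (B.Adj u)).card = d ∧
      (S.filter (B.Adj v)).card = d := by
  by_contra! hno
  set L := S.filter fun x => (S.filter (B.Adj x)).card = d with hL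
  set M := S.filter fun x => ¬ (S.filter (B.Adj x)).card = d with hM
  have hsum : ∑ x ∈ L, (S.filter (B.Adj x)).card + ∑ x ∈ M, (S.filter (B.Adj x)).card =
      ∑ x ∈ S, (S.filter (B.Adj x)).card := Finset.sum_filter_add_sum_filter_not _ _ _
  have hcard : L.card + M.card = S.card := Finset.card_filter_add_card_filter_not _
  have hLsum : ∑ x ∈ L, (S.filter (B.Adj x)).card = L.card * d := by
    rw [Finset.sum_const_nat]
    exact fun x hx => (Finset.mem_filter.1 hx).2
  have hMsum : M.card * (d + 1) ≤ ∑ x ∈ M, (S.filter (B.Adj x)).card := by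
    rw [← smul_eq_mul]
    refine Finset.card_nsmul_le_sum _ _ _ fun x hx => ?_
    have hx' := Finset.mem_filter.1 hx
    have := hd x hx'.1
    have := hx'.2
    omega
  have hLM : ∑ x ∈ L, (S.filter (B.Adj x)).card ≤ ∑ x ∈ M, (S.filter (B.Adj x)).card := by
    calc ∑ x ∈ L, (S.filter (B.Adj x)).card
        ≤ ∑ x ∈ L, (M.bipartiteAbove B.Adj x).card := by
          refine Finset.sum_le_sum fun x hx => Finset.card_le_card fun y hy => ?_
          have hx' := Finset.mem_filter.1 hx
          have hy' := Finset.mem_filter.1 hy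
          exact Finset.mem_filter.2 ⟨Finset.mem_filter.2
            ⟨hy'.1, hno x hx'.1 y hy'.1 hy'.2 hx'.2⟩, hy'.2⟩
      _ = ∑ y ∈ M, (L.bipartiteBelow B.Adj y).card :=
          Finset.sum_card_bipartiteAbove_eq_sum_card_bipartiteBelow _
      _ ≤ ∑ x ∈ M, (S.filter (B.Adj x)).card := by
          refine Finset.sum_le_sum fun x _ => Finset.card_le_card fun y hy => ?_
          have hy' := Finset.mem_filter.1 hy
          exact Finset.mem_filter.2 ⟨(Finset.mem_filter.1 hy'.1).1, hy'.2.symm⟩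
  rw [← hsum, ← hcard, hLsum] at hS
  rw [hLsum] at hLM
  nlinarith [Nat.mul_le_mul_left (2 * d) hMsum]

open Classical in
/-- A copy inside `S` covers all neighbours of a vertex whose degree is at most the minimum
degree. -/
lemma GraphCopy.exists_preimage {V W : Type*} [Finite W] {H : SimpleGraph W} {B : SimpleGraph V}
    {f : W ↪ V} (hf : GraphCopy H B f) {S : Finset V} (hS : ∀ w, f w ∈ S) {w : W}
    (hw : (S.filter (B.Adj (f w))).card ≤ (H.neighborSet w).ncard) {y : V} (hy : y ∈ S)
    (hadj : B.Adj (f w) y) : ∃ z, H.Adj w z ∧ f z = y := by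
  have hsub : f '' H.neighborSet w ⊆ (S.filter (B.Adj (f w)) : Finset V) := by
    rintro _ ⟨z, hz, rfl⟩
    exact Finset.mem_coe.2 (Finset.mem_filter.2 ⟨hS z, hf hz⟩)
  have heq := Set.eq_of_subset_of_ncard_le hsub (by
    rwa [Set.ncard_coe_finset, Set.ncard_image_of_injective _ f.injective])
  have : y ∈ f '' H.neighborSet w := by
    rw [heq]
    exact Finset.mem_coe.2 (Finset.mem_filter.2 ⟨hy, hadj⟩)
  exact this

open Classical in
lemma GraphCopy.ncard_neighborSet_le {V W : Type*} {H : SimpleGraph W} {B : SimpleGraph V}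
    {f : W ↪ V} (hf : GraphCopy H B f) {S : Finset V} (hS : ∀ w, f w ∈ S) (w : W) :
    (H.neighborSet w).ncard ≤ (S.filter (B.Adj (f w))).card := by
  rw [← Set.ncard_image_of_injective _ f.injective, ← Set.ncard_coe_finset]
  refine Set.ncard_le_ncard ?_ (Finset.finite_toSet _)
  rintro _ ⟨z, hz, rfl⟩
  exact Finset.mem_coe.2 (Finset.mem_filter.2 ⟨hS z, hf hz⟩)

open Classical in
/-- Sparse graphs have rainbow-free proper colourings. -/
lemma exists_rainbowFreeOn {V W : Type*} [Finite W] [Nonempty W] (H : SimpleGraph W)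
    (B : SimpleGraph V) {d : ℕ} (hd : 2 ≤ d) (hH : ∀ w, d ≤ (H.neighborSet w).ncard)
    (htri : d = 2 → ∀ x y z, H.Adj x y → H.Adj x z → ¬ H.Adj y z)
    (hB : ∀ S : Finset V, S.Nonempty →
      (2 * d + 1) * ∑ x ∈ S, (S.filter (B.Adj x)).card < 2 * (d * (d + 1)) * S.card)
    (S : Finset V) : ∃ χ, RainbowFreeOn H B S χ := by
  induction S using Finset.strongInduction with
  | H S ih =>
  rcases S.eq_empty_or_nonempty with rfl | hne
  · exact ⟨id, fun e _ h => h, fun e _ e' _ _ _ h _ => h, fun f _ h => by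
      simpa using h (Classical.arbitrary W)⟩
  by_cases hlow : ∃ u ∈ S, (S.filter (B.Adj u)).card < d
  · obtain ⟨u, hu, hud⟩ := hlow
    obtain ⟨χ, hχ⟩ := ih (S \ {u}) (Finset.sdiff_ssubset (by simpa using hu) (by simp))
    refine hχ.extend id (fun e _ h h' => ⟨h, h'⟩) (fun e _ e' _ h _ => h) ?_
    rintro f hf hS ⟨w, hw⟩
    rw [Finset.mem_singleton] at hw
    have h := hf.ncard_neighborSet_le hS w
    rw [hw] at h
    have := hH w
    omega
  push Not at hlow
  obtain ⟨u, hu, v, hv, huv, hud, hvd⟩ := exists_adj_of_sum_card_lt B (hB S hne) hlow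
  have hcover : ∀ f : W ↪ V, GraphCopy H B f → (∀ w, f w ∈ S) → (∃ w, f w ∈ ({u, v} : Finset V)) →
      ∃ a b, f a = u ∧ f b = v ∧ H.Adj a b ∧
        (∀ y ∈ S, B.Adj u y → ∃ z, H.Adj a z ∧ f z = y) ∧
        (∀ y ∈ S, B.Adj v y → ∃ z, H.Adj b z ∧ f z = y) := by
    rintro f hf hS ⟨w, hw⟩
    have hcov : ∀ c, (S.filter (B.Adj (f c))).card = d →
        ∀ y ∈ S, B.Adj (f c) y → ∃ z, H.Adj c z ∧ f z = y :=
      fun c hc y hy h => hf.exists_preimage hS (hc.trans_le (hH c)) hy h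
    rw [Finset.mem_insert, Finset.mem_singleton] at hw
    rcases hw with rfl | rfl
    · obtain ⟨b, hb, rfl⟩ := hcov w hud v hv huv
      exact ⟨w, b, rfl, rfl, hb, hcov w hud, hcov b hvd⟩
    · obtain ⟨a, ha, rfl⟩ := hcov w hvd u hu huv.symm
      exact ⟨a, w, rfl, rfl, ha.symm, hcov a hud, hcov w hvd⟩
  obtain ⟨χ, hχ⟩ := ih (S \ {u, v})
    (Finset.sdiff_ssubset (by simp [Finset.insert_subset_iff, hu, hv]) (by simp))
  obtain ⟨v', hv', hv'u⟩ : ∃ v' ∈ S.filter (B.Adj v), v' ≠ u :=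
    Finset.exists_mem_ne (by omega) u
  rw [Finset.mem_filter] at hv'
  by_cases hu' : ∃ u' ∈ S.filter (B.Adj u), u' ≠ v ∧ u' ≠ v'
  · obtain ⟨u', hu', hu'v, huv'⟩ := hu'
    rw [Finset.mem_filter] at hu'
    have hdisj : ¬ ∃ x, x ∈ s(v, v') ∧ x ∈ s(u, u') := by
      rintro ⟨x, hx, hx'⟩
      rw [Sym2.mem_iff] at hx hx'
      rcases hx with rfl | rfl <;> rcases hx' with h | h
      · exact huv.ne h.symm
      · exact hu'v h.symm
      · exact hv'u h
      · exact huv' h.symm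
    have hdne : s(u, u') ≠ s(v, v') := fun h =>
      hdisj ⟨v, Sym2.mem_mk_left _ _, h ▸ Sym2.mem_mk_left _ _⟩
    refine hχ.extend (Function.update id s(v, v') s(u, u')) ?_ ?_ ?_
    · intro e _ hS hR
      by_cases he : e = s(v, v')
      · subst he
        rw [Function.update_self]
        refine ⟨?_, u, Sym2.mem_mk_left _ _, by simp⟩
        intro x hx
        rcases Sym2.mem_iff.1 hx with rfl | rfl
        exacts [hu, hu'.1]
      · rw [Function.update_of_ne he]
        exact ⟨hS, hR⟩
    · rintro e - e' - hee hx
      by_cases he : e = s(v, v')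
      · subst he
        rw [Function.update_self, Function.update_of_ne hee.symm]
        rintro rfl
        exact hdisj hx
      · rw [Function.update_of_ne he]
        by_cases he' : e' = s(v, v')
        · subst he'
          rw [Function.update_self]
          rintro rfl
          obtain ⟨x, hx, hx'⟩ := hx
          exact hdisj ⟨x, hx', hx⟩
        · rwa [Function.update_of_ne he']
    · intro f hf hS hR
      obtain ⟨a, b, rfl, rfl, -, ha, hb⟩ := hcover f hf hS hR
      obtain ⟨a', haa', rfl⟩ := ha u' hu'.1 hu'.2
      obtain ⟨b', hbb', rfl⟩ := hb v' hv'.1 hv'.2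
      refine ⟨s(a, a'), haa', s(b, b'), hbb', ?_, ⟨f a, by simp, by simp⟩,
        ⟨f b, by simp, by simp⟩, ?_⟩
      · intro h
        apply hdne
        simpa using congrArg (Sym2.map f) h
      · rw [Sym2.map_mk, Sym2.map_mk, Function.update_self, Function.update_of_ne hdne, id]
  · push Not at hu'
    have hsub : S.filter (B.Adj u) ⊆ {v, v'} := by
      intro x hx
      rw [Finset.mem_insert, Finset.mem_singleton]
      exact or_iff_not_imp_left.2 (hu' x hx)
    have hle : ({v, v'} : Finset V).card ≤ 2 := Finset.card_le_two
    have hd2 : d = 2 := by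
      have := Finset.card_le_card hsub
      omega
    have hv'u : B.Adj u v' := by
      have := Finset.eq_of_subset_of_card_le hsub (by omega)
      have h : v' ∈ S.filter (B.Adj u) := by simp [this]
      exact (Finset.mem_filter.1 h).2
    refine hχ.extend id (fun e _ h h' => ⟨h, h'⟩) (fun e _ e' _ h _ => h) ?_
    intro f hf hS hR
    obtain ⟨a, b, rfl, rfl, hab, ha, hb⟩ := hcover f hf hS hR
    obtain ⟨c, hac, rfl⟩ := ha v' hv'.1 hv'u
    obtain ⟨c', hbc, hc⟩ := hb _ hv'.1 hv'.2
    obtain rfl := f.injective hc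
    exact absurd hbc (htri hd2 a b _ hab hac)

open Classical in
lemma sum_card_le_of_maxDensity {V : Type*} [Finite V] (B : SimpleGraph V) {S : Finset V}
    (hS : S.Nonempty) :
    ((∑ x ∈ S, (S.filter (B.Adj x)).card : ℕ) : ℝ) ≤ 2 * maxDensity B * S.card := by
  have := Fintype.ofFinite V
  set J : B.Subgraph := (⊤ : B.Subgraph).induce (S : Set V) with hJ
  have hbdd : BddAbove {x : ℝ | ∃ J : B.Subgraph, J.verts.Nonempty ∧
      x = (J.edgeSet.ncard : ℝ) / (J.verts.ncard : ℝ)} := by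
    refine (Set.Finite.subset (Set.finite_range fun J : B.Subgraph =>
      (J.edgeSet.ncard : ℝ) / (J.verts.ncard : ℝ)) ?_).bddAbove
    rintro _ ⟨J, -, rfl⟩
    exact ⟨J, rfl⟩
  have hle : (J.edgeSet.ncard : ℝ) / (S.card : ℝ) ≤ maxDensity B := by
    refine le_csSup hbdd ⟨J, by simpa [hJ] using hS, ?_⟩
    simp [hJ, Set.ncard_coe_finset]
  have hsum : ∑ x ∈ S, (S.filter (B.Adj x)).card = 2 * J.edgeSet.ncard := by
    rw [← Subgraph.edgeSet_spanningCoe, ← SimpleGraph.coe_edgeFinset, Set.ncard_coe_finset,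
      ← SimpleGraph.sum_degrees_eq_twice_card_edges]
    have hdeg : ∀ x, J.spanningCoe.degree x = if x ∈ S then (S.filter (B.Adj x)).card else 0 := by
      intro x
      rw [← SimpleGraph.card_neighborFinset_eq_degree]
      split_ifs with hx
      · congr 1
        ext y
        simp [hJ, hx]
      · rw [Finset.card_eq_zero]
        ext y
        simp [hJ, hx]
    simp [hdeg]
  have hpos : (0 : ℝ) < S.card := by exact_mod_cast hS.card_pos
  rw [div_le_iff₀ hpos] at hle
  rw [hsum]
  push_cast
  linarith

/-- A graph containing a triangle has `m₂` at least `2`. -/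
lemma two_le_twoDensity_of_triangle {W : Type*} [Finite W] {H : SimpleGraph W} {x y z : W}
    (hxy : H.Adj x y) (hxz : H.Adj x z) (hyz : H.Adj y z) : 2 ≤ twoDensity H := by
  have hbdd : BddAbove {t : ℝ | ∃ J : H.Subgraph, t = d2val J.edgeSet.ncard J.verts.ncard} := by
    refine (Set.Finite.subset (Set.finite_range fun J : H.Subgraph =>
      d2val J.edgeSet.ncard J.verts.ncard) ?_).bddAbove
    rintro _ ⟨J, rfl⟩
    exact ⟨J, rfl⟩
  refine le_csSup hbdd
    ⟨H.subgraphOfAdj hxy ⊔ H.subgraphOfAdj hxz ⊔ H.subgraphOfAdj hyz, ?_⟩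
  have hv : (H.subgraphOfAdj hxy ⊔ H.subgraphOfAdj hxz ⊔ H.subgraphOfAdj hyz).verts.ncard = 3 :=
    Set.ncard_eq_three.2 ⟨x, y, z, hxy.ne, hxz.ne, hyz.ne, by
      ext t
      simp
      tauto⟩
  have he : (H.subgraphOfAdj hxy ⊔ H.subgraphOfAdj hxz ⊔ H.subgraphOfAdj hyz).edgeSet.ncard = 3 :=
    Set.ncard_eq_three.2 ⟨s(x, y), s(x, z), s(y, z), by simp [hyz.ne, hxz.ne],
      by simp [hxy.ne, hxz.ne], by simp [hxy.ne, hxz.ne], by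
      ext t
      simp
      tauto⟩
  rw [hv, he]
  norm_num [d2val]

/-- the colouring statement for sparse strictly 2-balanced graphs. -/
theorem stmt_6 {W : Type} [Fintype W] (H : SimpleGraph W)
    (hbal : StrictlyTwoBalanced H) (hm1 : 1 < twoDensity H)
    (hm2 : twoDensity H <
      ((minDeg H : ℝ) * ((minDeg H : ℝ) + 1)) / (2 * (minDeg H : ℝ) + 1))
    {V : Type} [Fintype V] (B : SimpleGraph V)
    (hB : maxDensity B ≤ twoDensity H) :
    ¬ AntiRamsey B H := by
  set d := minDeg H with hd_def
  have hpos : (0 : ℝ) < 2 * (d : ℝ) + 1 := by positivity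
  have hd : 2 ≤ d := by
    by_contra! hlt
    have h := hm1.trans hm2
    rw [lt_div_iff₀ hpos] at h
    interval_cases d <;> norm_num at h
  have hH : ∀ w, d ≤ (H.neighborSet w).ncard := fun w => Nat.sInf_le ⟨w, rfl⟩
  have : Nonempty W := by
    by_contra hW
    rw [not_nonempty_iff] at hW
    have : d = 0 := by simp [hd_def, minDeg]
    omega
  have htri : d = 2 → ∀ x y z, H.Adj x y → H.Adj x z → ¬ H.Adj y z := by
    intro hd2 x y z hxy hxz hyz
    have h := (two_le_twoDensity_of_triangle hxy hxz hyz).trans_lt hm2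
    rw [hd2] at h
    norm_num at h
  classical
  obtain ⟨χ, -, hproper, hcopy⟩ := exists_rainbowFreeOn H B hd hH htri (fun S hS => by
    have h1 := sum_card_le_of_maxDensity B hS
    have h2 := hB.trans_lt hm2
    rw [lt_div_iff₀ hpos] at h2
    have hS' : (0 : ℝ) < S.card := by exact_mod_cast hS.card_pos
    have h3 := mul_le_mul_of_nonneg_left h1 hpos.le
    have h4 := mul_lt_mul_of_pos_right h2 hS'
    have h5 : (2 * (d : ℝ) + 1) * ((∑ x ∈ S, (S.filter (B.Adj x)).card : ℕ) : ℝ) <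
        2 * (d * (d + 1)) * S.card := by linarith
    exact_mod_cast h5) Finset.univ
  intro hAR
  obtain ⟨f, hf, hrb⟩ := hAR (Sym2 V) χ fun e he e' he' =>
    hproper e he e' he' (fun _ _ => Finset.mem_univ _) (fun _ _ => Finset.mem_univ _)
  obtain ⟨e, he, e', he', hne, heq⟩ := hcopy f hf fun _ => Finset.mem_univ _
  exact hrb e he e' he' hne heq
end

section
/- Let d ≥ 1 be an integer and let B be a nonempty graph with minimum degree at least d satisfying e(B)/v(B) < d(d+1)/(2d+1). Then B contains two adjacent vertices that both have degree exactly d. -/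
open SimpleGraph Filter

open Classical in
/-- The edges meeting an independent set `D` are counted exactly once by the degrees in `D`. -/
theorem sum_degree_le_card_edgeFinset_of_pairwise_not_adj {V : Type*} [Fintype V]
    (B : SimpleGraph V) (D : Finset V) (hD : ∀ u ∈ D, ∀ v ∈ D, ¬ B.Adj u v) :
    ∑ v ∈ D, B.degree v ≤ B.edgeFinset.card := by
  have hdisj : ∀ u ∈ D, ∀ v ∈ D, u ≠ v →
      Disjoint (B.incidenceFinset u) (B.incidenceFinset v) := by
    intro u hu v hv huv
    rw [← Finset.disjoint_coe, coe_incidenceFinset, coe_incidenceFinset,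
      Set.disjoint_iff_inter_eq_empty]
    exact B.incidenceSet_inter_incidenceSet_of_not_adj (hD u hu v hv) huv
  simp_rw [← card_incidenceFinset_eq_degree]
  rw [← Finset.card_biUnion hdisj]
  exact Finset.card_le_card (Finset.biUnion_subset.2 fun v _ => B.incidenceFinset_subset v)

/-- a nonempty graph with minimum degree at least `d` and density less than
`d(d+1)/(2d+1)` has two adjacent vertices of degree exactly `d`. -/
theorem stmt_7 {V : Type} [Fintype V] [Nonempty V] (B : SimpleGraph V) (d : ℕ)
    (hd : 1 ≤ d)
    (hmin : ∀ v : V, d ≤ (B.neighborSet v).ncard)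
    (hdens : (B.edgeSet.ncard : ℝ) / (Fintype.card V : ℝ) <
      ((d : ℝ) * ((d : ℝ) + 1)) / (2 * (d : ℝ) + 1)) :
    ∃ u v : V, B.Adj u v ∧ (B.neighborSet u).ncard = d ∧ (B.neighborSet v).ncard = d := by
  classical
  have hdeg (v : V) : (B.neighborSet v).ncard = B.degree v := by
    rw [Set.ncard_eq_toFinset_card', ← SimpleGraph.card_neighborFinset_eq_degree]
    rfl
  have hedge : B.edgeSet.ncard = B.edgeFinset.card := by
    rw [Set.ncard_eq_toFinset_card']
    rfl
  simp only [hdeg] at hmin ⊢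
  rw [hedge] at hdens
  by_contra! hcon
  let D : Finset V := {v | B.degree v = d}
  have hmemD (v : V) : v ∈ D ↔ B.degree v = d := by simp [D]
  have hsumD : ∑ v ∈ D, B.degree v = D.card * d := by
    rw [Finset.sum_congr rfl fun v hv => (hmemD v).1 hv, Finset.sum_const, smul_eq_mul]
  have hlow : D.card * d ≤ B.edgeFinset.card := by
    rw [← hsumD]
    refine sum_degree_le_card_edgeFinset_of_pairwise_not_adj B D fun u hu v hv huv => ?_
    exact hcon u v huv ((hmemD u).1 hu) ((hmemD v).1 hv)
  have hhigh : Dᶜ.card * (d + 1) ≤ ∑ v ∈ Dᶜ, B.degree v := by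
    rw [← smul_eq_mul]
    refine Finset.card_nsmul_le_sum _ _ _ fun v hv => ?_
    have hne : B.degree v ≠ d := by rwa [Finset.mem_compl, hmemD] at hv
    have := hmin v
    omega
  have htotal : ∑ v ∈ D, B.degree v + ∑ v ∈ Dᶜ, B.degree v = 2 * B.edgeFinset.card := by
    rw [Finset.sum_add_sum_compl, sum_degrees_eq_twice_card_edges]
  have hcard : D.card + Dᶜ.card = Fintype.card V := Finset.card_add_card_compl D
  have hn : (0 : ℝ) < Fintype.card V := by exact_mod_cast Fintype.card_pos
  rw [div_lt_div_iff₀ hn (by positivity)] at hdens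
  have hdens' : B.edgeFinset.card * (2 * d + 1) < d * (d + 1) * Fintype.card V := by
    exact_mod_cast hdens
  rw [← hcard] at hdens'
  rw [hsumD] at htotal
  have hsum : D.card * d + Dᶜ.card * (d + 1) ≤ 2 * B.edgeFinset.card := by omega
  nlinarith [Nat.mul_le_mul_left d hsum]
end
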